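/- arXiv:1902.10878 — 5 statements merged into one kernel-verified Lean document; each statement's English description precedes it below -/
import Mathlib

section
/- Let x, y, z ∈ (0,1]. Then every graph that is (x,y)-constrained via a tripartition (A,B,C) contains a vertex v ∈ C with |N²_A(v)| ≥ z·|A| if and only if every graph that is (y,x)-constrained via a tripartition (A,B,C) contains a vertex v ∈ C with |N²_A(v)| ≥ z·|A|. (Equivalently, φ(x,y) = φ(y,x), where φ(x,y) is the maximum z ∈ (0,1] with the first property.) -/
open Set

/-- A set of vertices is stable if no two of its members are adjacent. -/
def StableSet {V : Type*} (G : SimpleGraph V) (S : Set V) : Prop :=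
  ∀ u ∈ S, ∀ v ∈ S, ¬ G.Adj u v

/-- A tripartition of a graph `G` is a partition of its vertex set into three
nonempty stable sets. -/
def IsTripartition {V : Type*} (G : SimpleGraph V) (A B C : Set V) : Prop :=
  A.Nonempty ∧ B.Nonempty ∧ C.Nonempty ∧
  Disjoint A B ∧ Disjoint A C ∧ Disjoint B C ∧
  A ∪ B ∪ C = Set.univ ∧
  StableSet G A ∧ StableSet G B ∧ StableSet G C

/-- The number of neighbours of `v` inside the set `S`. -/
noncomputable def nbrCard {V : Type*} (G : SimpleGraph V) (v : V) (S : Set V) : ℕ :=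
  (S ∩ G.neighborSet v).ncard

/-- `G` is `(x,y)`-constrained via the tripartition `(A,B,C)`. -/
def Constrained {V : Type*} (G : SimpleGraph V) (x y : ℝ) (A B C : Set V) : Prop :=
  IsTripartition G A B C ∧
  (∀ v ∈ A, x * B.ncard ≤ (nbrCard G v B : ℝ)) ∧
  (∀ v ∈ B, y * C.ncard ≤ (nbrCard G v C : ℝ)) ∧
  (∀ u ∈ A, ∀ v ∈ C, ¬ G.Adj u v)

/-- `G` is `(x,y)`-biconstrained via the tripartition `(A,B,C)`. -/
def Biconstrained {V : Type*} (G : SimpleGraph V) (x y : ℝ) (A B C : Set V) : Prop :=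
  Constrained G x y A B C ∧
  (∀ v ∈ B, x * A.ncard ≤ (nbrCard G v A : ℝ)) ∧
  (∀ v ∈ C, y * B.ncard ≤ (nbrCard G v B : ℝ))

/-- `N²(v)`: the set of vertices at distance exactly two from `v`. -/
def N2 {V : Type*} (G : SimpleGraph V) (v : V) : Set V :=
  {u | ¬ G.Adj v u ∧ v ≠ u ∧ ∃ w, G.Adj v w ∧ G.Adj w u}

/-- `|N²(v) ∩ A|`. -/
noncomputable def n2card {V : Type*} (G : SimpleGraph V) (v : V) (A : Set V) : ℕ :=
  (N2 G v ∩ A).ncard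

/-- Gordan's theorem of the alternative for finitely many linear functionals over `ℚ`. -/
theorem gordan_alternative {ι W : Type*} [AddCommGroup W] [Module ℚ W]
    (s : Finset ι) (f : ι → W →ₗ[ℚ] ℚ) :
    (∃ w, ∀ i ∈ s, f i w < 0) ∨
      ∃ c : ι → ℚ, (∀ i ∈ s, 0 ≤ c i) ∧ (∃ i ∈ s, c i ≠ 0) ∧ ∑ i ∈ s, c i • f i = 0 := by
  classical
  have perturb : ∀ (t : Finset ι) (g : ι → W →ₗ[ℚ] ℚ) (w u : W), (∀ i ∈ t, g i w < 0) →
      ∃ ε : ℚ, 0 < ε ∧ ∀ i ∈ t, g i (w + ε • u) < 0 := by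
    intro t g w u h
    have hev : ∀ᶠ ε : ℚ in nhdsWithin 0 (Set.Ioi 0), ∀ i ∈ t, g i (w + ε • u) < 0 := by
      rw [Filter.eventually_all_finset]
      intro i hi
      have hc : Continuous fun ε : ℚ => g i (w + ε • u) := by
        simp only [map_add, map_smul, smul_eq_mul]
        fun_prop
      refine (hc.tendsto 0).eventually_lt_const ?_ |>.filter_mono nhdsWithin_le_nhds
      simpa using h i hi
    obtain ⟨ε, h1, h2⟩ := (hev.and self_mem_nhdsWithin).exists
    exact ⟨ε, h2, h1⟩
  induction s using Finset.induction_on generalizing f with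
  | empty => exact Or.inl ⟨0, by simp⟩
  | insert m s hm ih =>
    have extend : ∀ (c : ι → ℚ) (d : ℚ), (∀ i ∈ s, 0 ≤ c i) → 0 ≤ d →
        ((∃ i ∈ s, c i ≠ 0) ∨ d ≠ 0) → (∑ i ∈ s, c i • f i) + d • f m = 0 →
        ∃ c : ι → ℚ, (∀ i ∈ insert m s, 0 ≤ c i) ∧ (∃ i ∈ insert m s, c i ≠ 0) ∧
          ∑ i ∈ insert m s, c i • f i = 0 := by
      intro c d hc hd hne hsum
      have hs : ∀ i ∈ s, i ≠ m := fun i hi h => hm (h ▸ hi)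
      refine ⟨Function.update c m d, ?_, ?_, ?_⟩
      · intro i hi
        rcases Finset.mem_insert.1 hi with rfl | hi
        · simpa
        · simpa [Function.update_of_ne (hs i hi)] using hc i hi
      · rcases hne with ⟨i, hi, h⟩ | h
        · exact ⟨i, Finset.mem_insert_of_mem hi, by simpa [Function.update_of_ne (hs i hi)]⟩
        · exact ⟨m, Finset.mem_insert_self _ _, by simpa⟩
      · rw [Finset.sum_insert hm, ← hsum, add_comm]
        congr 1
        · exact Finset.sum_congr rfl fun i hi => by rw [Function.update_of_ne (hs i hi)]
        · simp
    rcases ih f with ⟨w, hw⟩ | ⟨c, hc, hne, hsum⟩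
    swap
    · exact Or.inr (extend c 0 hc le_rfl (Or.inl hne) (by simpa using hsum))
    by_cases hfm : f m = 0
    · exact Or.inr (extend 0 1 (by simp) zero_le_one (Or.inr one_ne_zero) (by simp [hfm]))
    rcases lt_trichotomy (f m w) 0 with hlt | heq | hgt
    · exact Or.inl ⟨w, by simpa using ⟨hlt, hw⟩⟩
    · obtain ⟨u, hu⟩ : ∃ u, f m u < 0 := by
        obtain ⟨u, hu⟩ : ∃ u, f m u ≠ 0 := by
          by_contra! h
          exact hfm (LinearMap.ext h)
        rcases lt_or_gt_of_ne hu with h | h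
        · exact ⟨u, h⟩
        · exact ⟨-u, by simpa⟩
      obtain ⟨ε, hε, h⟩ := perturb s f w u hw
      refine Or.inl ⟨w + ε • u, ?_⟩
      rw [Finset.forall_mem_insert]
      exact ⟨by simpa [heq] using mul_neg_of_pos_of_neg hε hu, h⟩
    · rcases ih (fun i => f i - (f i w / f m w) • f m) with ⟨v, hv⟩ | ⟨c, hc, hne, hsum⟩
      · set u := v - (f m v / f m w) • w with hu
        have hmu : f m u = 0 := by
          simp only [hu, map_sub, map_smul, smul_eq_mul]
          field_simp
          ring
        have hsu : ∀ i ∈ s, f i u < 0 := by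
          intro i hi
          have := hv i hi
          simp only [LinearMap.sub_apply, LinearMap.smul_apply, smul_eq_mul] at this
          simp only [hu, map_sub, map_smul, smul_eq_mul]
          calc _ = f i v - f i w / f m w * f m v := by ring
            _ < 0 := this
        obtain ⟨ε, hε, h⟩ := perturb s f u (-w) hsu
        refine Or.inl ⟨u + ε • (-w), ?_⟩
        rw [Finset.forall_mem_insert]
        exact ⟨by simpa [hmu] using mul_pos hε hgt, h⟩
      · refine Or.inr (extend c (∑ i ∈ s, c i * (-(f i w) / f m w)) hc ?_ (Or.inl hne) ?_)
        · exact Finset.sum_nonneg fun i hi =>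
            mul_nonneg (hc i hi) (div_nonneg (by linarith [hw i hi]) hgt.le)
        · rw [← hsum, Finset.sum_smul, ← Finset.sum_add_distrib]
          refine Finset.sum_congr rfl fun i _ => ?_
          rw [smul_sub, smul_smul, sub_eq_add_neg, ← neg_smul]
          congr 2
          ring

/-- Ville's theorem of the alternative for the submatrix of `K` with rows `s` and columns `t`. -/
theorem ville_alternative {ι κ : Type*} (s : Finset ι) (t : Finset κ) (K : ι → κ → ℚ) :
    (∃ w : κ → ℚ, (∀ k ∈ t, 0 ≤ w k) ∧ ∀ i ∈ s, ∑ k ∈ t, K i k * w k < 0) ∨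
      ∃ c : ι → ℚ, (∀ i ∈ s, 0 ≤ c i) ∧ (∃ i ∈ s, c i ≠ 0) ∧
        ∀ k ∈ t, 0 ≤ ∑ i ∈ s, c i * K i k := by
  classical
  let f : ι ⊕ κ → (κ → ℚ) →ₗ[ℚ] ℚ :=
    Sum.elim (fun i => ∑ k ∈ t, K i k • LinearMap.proj k) (fun k => -LinearMap.proj k)
  rcases gordan_alternative (s.disjSum t) f with ⟨w, hw⟩ | ⟨c, hc, hne, hsum⟩
  · refine Or.inl ⟨w, fun k hk => ?_, fun i hi => ?_⟩
    · have := hw (Sum.inr k) (by simpa using hk)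
      simp only [f, Sum.elim_inr, LinearMap.neg_apply, LinearMap.proj_apply] at this
      linarith
    · simpa [f, LinearMap.sum_apply] using hw (Sum.inl i) (by simpa using hi)
  · have key : ∀ k ∈ t, ∑ i ∈ s, c (Sum.inl i) * K i k = c (Sum.inr k) := by
      intro k hk
      have := congrArg (fun g : (κ → ℚ) →ₗ[ℚ] ℚ => g (Pi.single k 1)) hsum
      simp [f, LinearMap.sum_apply, Finset.sum_disjSum, Pi.single_apply, hk] at this
      linarith
    refine Or.inr ⟨fun i => c (Sum.inl i), fun i hi => hc _ (by simpa using hi), ?_, fun k hk => ?_⟩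
    · by_contra! h
      obtain ⟨j, hj, hj0⟩ := hne
      rcases j with i | k
      · exact hj0 (h i (by simpa using hj))
      · have hk : k ∈ t := by simpa using hj
        refine hj0 ?_
        rw [← key k hk]
        exact Finset.sum_eq_zero fun i hi => by rw [h i hi, zero_mul]
    · rw [key k hk]
      exact hc _ (by simpa using hk)

/-- A nonnegative solution of `K β ≥ 0` on the rows `s` either can be replaced by one of strictly
smaller support, or the transposed system on its support has a nonzero nonnegative solution. -/
theorem exists_support_ssubset_or_dual {ι κ : Type*} [Fintype ι] [Fintype κ]
    (α : ι → ℚ) (hα : α ≠ 0) (K : ι → κ → ℚ) (β : κ → ℚ) (hβ : 0 ≤ β)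
    (h : ∀ i, α i ≠ 0 → 0 ≤ ∑ k, K i k * β k) :
    (∃ β' : κ → ℚ, 0 ≤ β' ∧ β' ≠ 0 ∧ Function.support β' ⊂ Function.support β ∧
      ∀ i, α i ≠ 0 → 0 ≤ ∑ k, K i k * β' k) ∨
    ∃ c : ι → ℚ, 0 ≤ c ∧ c ≠ 0 ∧ (∀ i, c i ≠ 0 → α i ≠ 0) ∧
      ∀ k, β k ≠ 0 → 0 ≤ ∑ i, c i * K i k := by
  classical
  rcases ville_alternative (Finset.univ.filter (α · ≠ 0)) (Finset.univ.filter (β · ≠ 0)) K with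
    ⟨w, hw0, hw⟩ | ⟨c, hc, ⟨i, hi, hne⟩, hsum⟩
  · left
    set v : κ → ℚ := fun k => if β k ≠ 0 then w k else 0 with hv
    have hv0 : ∀ k, 0 ≤ v k := by
      intro k
      by_cases hk : β k = 0
      · simp [hv, hk]
      · simpa [hv, hk] using hw0 k (by simpa using hk)
    have hKv : ∀ i, α i ≠ 0 → ∑ k, K i k * v k < 0 := by
      intro i hi
      simpa [hv, Finset.sum_filter, ite_not] using hw i (by simpa using hi)
    obtain ⟨i, hi⟩ := Function.ne_iff.1 hα
    have hne : (Finset.univ.filter (v · ≠ 0)).Nonempty := by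
      by_contra! he
      have : ∀ k, v k = 0 := by simpa [Finset.filter_eq_empty_iff] using he
      have := hKv i hi
      simp_all
    obtain ⟨k₀, hk₀, hmin⟩ := Finset.exists_min_image _ (fun k => β k / v k) hne
    have hvk₀ : v k₀ ≠ 0 := by simpa using hk₀
    have hβk₀ : β k₀ ≠ 0 := fun h0 => hvk₀ (by simp [hv, h0])
    have hpos : 0 < β k₀ / v k₀ :=
      div_pos ((hβ k₀).lt_of_ne' hβk₀) ((hv0 k₀).lt_of_ne' hvk₀)
    have hsum : ∀ i, α i ≠ 0 → 0 < ∑ k, K i k * (β k - β k₀ / v k₀ * v k) := by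
      intro i hi
      have : ∑ k, K i k * (β k - β k₀ / v k₀ * v k) =
          ∑ k, K i k * β k - β k₀ / v k₀ * ∑ k, K i k * v k := by
        rw [Finset.mul_sum, ← Finset.sum_sub_distrib]
        exact Finset.sum_congr rfl fun k _ => by ring
      rw [this]
      nlinarith [h i hi, mul_neg_of_pos_of_neg hpos (hKv i hi)]
    refine ⟨fun k => β k - β k₀ / v k₀ * v k, fun k => ?_, fun h0 => ?_, ?_,
      fun i hi => (hsum i hi).le⟩
    · by_cases hk : v k = 0
      · simpa [hk] using hβ k
      · have := hmin k (by simpa using hk)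
        rw [le_div_iff₀ ((hv0 k).lt_of_ne' hk)] at this
        simpa using this
    · have := hsum i hi
      have h0' : ∀ k, β k - β k₀ / v k₀ * v k = 0 := congrFun h0
      simp [h0'] at this
    · refine Set.ssubset_iff_subset_ne.2 ⟨fun k hk hk0 => hk ?_, fun he => ?_⟩
      · simp [hv, hk0]
      · have : k₀ ∈ Function.support β := hβk₀
        rw [← he] at this
        exact this (by simp [hvk₀])
  · right
    have hi' : α i ≠ 0 := by simpa using hi
    refine ⟨fun i => if α i ≠ 0 then c i else 0, fun i => ?_, fun h0 => ?_, fun i hi0 => ?_,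
      fun k hk => ?_⟩
    · by_cases hi : α i = 0
      · simp [hi]
      · simpa [hi] using hc i (by simpa using hi)
    · have := congrFun h0 i
      simp [hi', hne] at this
    · by_contra hn
      simp [hn] at hi0
    · simpa [Finset.sum_filter, ite_not] using hsum k (by simpa using hk)

/-- Reversal of a cyclic system of weighted degree conditions on three finite sets. -/
theorem cyclic_duality {X Y Z : Type*} [Fintype X] [Fintype Y] [Fintype Z]
    (K : X → Y → ℚ) (L : Y → Z → ℚ) (M : Z → X → ℚ)
    (h : ∃ (α : X → ℚ) (β : Y → ℚ) (γ : Z → ℚ), 0 ≤ α ∧ α ≠ 0 ∧ 0 ≤ β ∧ β ≠ 0 ∧ 0 ≤ γ ∧ γ ≠ 0 ∧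
      (∀ i, α i ≠ 0 → 0 ≤ ∑ j, K i j * β j) ∧ (∀ j, β j ≠ 0 → 0 ≤ ∑ k, L j k * γ k) ∧
      (∀ k, γ k ≠ 0 → 0 ≤ ∑ i, M k i * α i)) :
    ∃ (α : X → ℚ) (β : Y → ℚ) (γ : Z → ℚ), 0 ≤ α ∧ α ≠ 0 ∧ 0 ≤ β ∧ β ≠ 0 ∧ 0 ≤ γ ∧ γ ≠ 0 ∧
      (∀ j, β j ≠ 0 → 0 ≤ ∑ i, α i * K i j) ∧ (∀ k, γ k ≠ 0 → 0 ≤ ∑ j, β j * L j k) ∧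
      (∀ i, α i ≠ 0 → 0 ≤ ∑ k, γ k * M k i) := by
  obtain ⟨α, β, γ, hα, hα0, hβ, hβ0, hγ, hγ0, hK, hL, hM⟩ := h
  induction hn : (Function.support α).ncard + (Function.support β).ncard +
    (Function.support γ).ncard using Nat.strong_induction_on generalizing α β γ with
  | _ n ih =>
    subst hn
    rcases exists_support_ssubset_or_dual α hα0 K β hβ hK with
      ⟨β', h1, h2, h3, h4⟩ | ⟨α', hα', hα0', hαs, hK'⟩
    · exact ih _ (by have := Set.ncard_lt_ncard h3; omega) α β' γ hα hα0 h1 h2 hγ hγ0 h4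
        (fun j hj => hL j (h3.subset hj)) hM rfl
    rcases exists_support_ssubset_or_dual β hβ0 L γ hγ hL with
      ⟨γ', h1, h2, h3, h4⟩ | ⟨β', hβ', hβ0', hβs, hL'⟩
    · exact ih _ (by have := Set.ncard_lt_ncard h3; omega) α β γ' hα hα0 hβ hβ0 h1 h2 hK h4
        (fun k hk => hM k (h3.subset hk)) rfl
    rcases exists_support_ssubset_or_dual γ hγ0 M α hα hM with
      ⟨α'', h1, h2, h3, h4⟩ | ⟨γ', hγ', hγ0', hγs, hM'⟩
    · exact ih _ (by have := Set.ncard_lt_ncard h3; omega) α'' β γ h1 h2 hβ hβ0 hγ hγ0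
        (fun i hi => hK i (h3.subset hi)) hL h4 rfl
    exact ⟨α', β', γ', hα', hα0', hβ', hβ0', hγ', hγ0', fun j hj => hK' j (hβs j hj),
      fun k hk => hL' k (hγs k hk), fun i hi => hM' i (hαs i hi)⟩

/-- A nonnegative rational weighting has a positive multiple with natural number values. -/
theorem exists_nat_weight {X : Type*} [Fintype X] (α : X → ℚ) (hα : 0 ≤ α) :
    ∃ (n : X → ℕ) (N : ℚ), 0 < N ∧ ∀ i, (n i : ℚ) = N * α i := by
  classical
  refine ⟨fun i => (α i).num.toNat * ∏ j ∈ Finset.univ.erase i, (α j).den,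
    ((∏ j, (α j).den : ℕ) : ℚ), ?_, fun i => ?_⟩
  · exact_mod_cast Finset.prod_pos fun j _ => (α j).den_pos
  · have hnum : (((α i).num.toNat : ℕ) : ℚ) = (α i).num := by
      exact_mod_cast Int.toNat_of_nonneg (Rat.num_nonneg.2 (hα i))
    rw [← Finset.mul_prod_erase _ _ (Finset.mem_univ i)]
    push_cast
    rw [hnum]
    conv_lhs => rw [← Rat.den_mul_eq_num (α i)]
    ring

/-- The zeros of a weighting are not changed by positive scaling. -/
theorem eq_zero_iff_of_scaled {X : Type*} {n : X → ℕ} {α : X → ℚ} {N : ℚ} (hN : 0 < N)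
    (hn : ∀ i, (n i : ℚ) = N * α i) (i : X) : n i = 0 ↔ α i = 0 := by
  rw [← Nat.cast_eq_zero (R := ℚ), hn, mul_eq_zero, or_iff_right hN.ne']

theorem ne_zero_of_scaled {X : Type*} {n : X → ℕ} {α : X → ℚ} {N : ℚ} (hN : 0 < N)
    (hn : ∀ i, (n i : ℚ) = N * α i) (hα : α ≠ 0) : n ≠ 0 :=
  fun h => hα (funext fun i => (eq_zero_iff_of_scaled hN hn i).1 (congrFun h i))

theorem sum_nonneg_of_scaled {X : Type*} [Fintype X] {n : X → ℕ} {α : X → ℚ} {N : ℚ} (hN : 0 < N)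
    (hn : ∀ i, (n i : ℚ) = N * α i) {g : X → ℚ} (hg : 0 ≤ ∑ i, α i * g i) :
    0 ≤ ∑ i, (n i : ℚ) * g i := by
  simp only [hn, mul_assoc, ← Finset.mul_sum]
  exact mul_nonneg hN.le hg

/-- `cyclic_duality` with natural number weights in the conclusion. -/
theorem cyclic_duality_nat {X Y Z : Type*} [Fintype X] [Fintype Y] [Fintype Z]
    (K : X → Y → ℚ) (L : Y → Z → ℚ) (M : Z → X → ℚ)
    (h : ∃ (α : X → ℚ) (β : Y → ℚ) (γ : Z → ℚ), 0 ≤ α ∧ α ≠ 0 ∧ 0 ≤ β ∧ β ≠ 0 ∧ 0 ≤ γ ∧ γ ≠ 0 ∧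
      (∀ i, α i ≠ 0 → 0 ≤ ∑ j, K i j * β j) ∧ (∀ j, β j ≠ 0 → 0 ≤ ∑ k, L j k * γ k) ∧
      (∀ k, γ k ≠ 0 → 0 ≤ ∑ i, M k i * α i)) :
    ∃ (α : X → ℕ) (β : Y → ℕ) (γ : Z → ℕ), α ≠ 0 ∧ β ≠ 0 ∧ γ ≠ 0 ∧
      (∀ j, β j ≠ 0 → 0 ≤ ∑ i, (α i : ℚ) * K i j) ∧
      (∀ k, γ k ≠ 0 → 0 ≤ ∑ j, (β j : ℚ) * L j k) ∧
      (∀ i, α i ≠ 0 → 0 ≤ ∑ k, (γ k : ℚ) * M k i) := by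
  obtain ⟨α, β, γ, hα, hα0, hβ, hβ0, hγ, hγ0, hK, hL, hM⟩ := cyclic_duality K L M h
  obtain ⟨a, N₁, h₁, ha⟩ := exists_nat_weight α hα
  obtain ⟨b, N₂, h₂, hb⟩ := exists_nat_weight β hβ
  obtain ⟨c, N₃, h₃, hc⟩ := exists_nat_weight γ hγ
  exact ⟨a, b, c, ne_zero_of_scaled h₁ ha hα0, ne_zero_of_scaled h₂ hb hβ0,
    ne_zero_of_scaled h₃ hc hγ0,
    fun j hj => sum_nonneg_of_scaled h₁ ha (hK j (mt (eq_zero_iff_of_scaled h₂ hb j).2 hj)),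
    fun k hk => sum_nonneg_of_scaled h₂ hb (hL k (mt (eq_zero_iff_of_scaled h₃ hc k).2 hk)),
    fun i hi => sum_nonneg_of_scaled h₃ hc (hM i (mt (eq_zero_iff_of_scaled h₁ ha i).2 hi))⟩

/-- The tripartite graph given by a relation between the first two parts and a relation between the
last two parts. -/
def tripartiteGraph {X Y Z : Type*} (R : X → Y → Prop) (S : Y → Z → Prop) :
    SimpleGraph (X ⊕ Y ⊕ Z) :=
  SimpleGraph.fromRel fun u v =>
    match u, v with
    | Sum.inl a, Sum.inr (Sum.inl b) => R a b
    | Sum.inr (Sum.inl b), Sum.inr (Sum.inr c) => S b c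
    | _, _ => False

section TripartiteGraph

variable {X Y Z : Type*} (R : X → Y → Prop) (S : Y → Z → Prop)

theorem constrained_tripartiteGraph [Nonempty X] [Nonempty Y] [Nonempty Z] {x y : ℝ}
    (hR : ∀ a, x * Nat.card Y ≤ ({b | R a b}.ncard : ℝ))
    (hS : ∀ b, y * Nat.card Z ≤ ({c | S b c}.ncard : ℝ)) :
    Constrained (tripartiteGraph R S) x y (Set.range Sum.inl) (Set.range (Sum.inr ∘ Sum.inl))
      (Set.range (Sum.inr ∘ Sum.inr)) := by
  have hY : Function.Injective (Sum.inr ∘ Sum.inl : Y → X ⊕ Y ⊕ Z) :=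
    Sum.inr_injective.comp Sum.inl_injective
  have hZ : Function.Injective (Sum.inr ∘ Sum.inr : Z → X ⊕ Y ⊕ Z) :=
    Sum.inr_injective.comp Sum.inr_injective
  refine ⟨⟨Set.range_nonempty _, Set.range_nonempty _, Set.range_nonempty _, ?_, ?_, ?_, ?_, ?_,
    ?_, ?_⟩, ?_, ?_, ?_⟩
  · simp [Set.disjoint_left]
  · simp [Set.disjoint_left]
  · simp [Set.disjoint_left]
  · ext (a | b | c) <;> simp
  · simp [StableSet, tripartiteGraph]
  · simp [StableSet, tripartiteGraph]
  · simp [StableSet, tripartiteGraph]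
  · rintro _ ⟨a, rfl⟩
    have : Set.range (Sum.inr ∘ Sum.inl) ∩ (tripartiteGraph R S).neighborSet (Sum.inl a) =
        (Sum.inr ∘ Sum.inl) '' {b | R a b} := by
      ext (a | b | c) <;> simp [tripartiteGraph]
    rw [nbrCard, this, Set.ncard_image_of_injective _ hY, Set.ncard_range_of_injective hY]
    exact hR a
  · rintro _ ⟨b, rfl⟩
    have : Set.range (Sum.inr ∘ Sum.inr) ∩
        (tripartiteGraph R S).neighborSet ((Sum.inr ∘ Sum.inl) b) =
        (Sum.inr ∘ Sum.inr) '' {c | S b c} := by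
      ext (a | b | c) <;> simp [tripartiteGraph]
    rw [nbrCard, this, Set.ncard_image_of_injective _ hZ, Set.ncard_range_of_injective hZ]
    exact hS b
  · simp [tripartiteGraph]

theorem n2card_tripartiteGraph (c : Z) :
    n2card (tripartiteGraph R S) (Sum.inr (Sum.inr c)) (Set.range Sum.inl) =
      {a | ∃ b, R a b ∧ S b c}.ncard := by
  have : N2 (tripartiteGraph R S) (Sum.inr (Sum.inr c)) ∩ Set.range Sum.inl =
      Sum.inl '' {a | ∃ b, R a b ∧ S b c} := by
    ext (a | b | c) <;> simp [N2, tripartiteGraph, and_comm]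
  rw [n2card, this, Set.ncard_image_of_injective _ Sum.inl_injective]

end TripartiteGraph

/-- A set that is a union of blocks of a blow-up has the total weight of these blocks as size. -/
theorem ncard_blowup {X : Type*} [Fintype X] (n : X → ℕ) (P : X → Prop) [DecidablePred P] :
    {p : Σ i, Fin (n i) | P p.1}.ncard = ∑ i, if P i then n i else 0 := by
  classical
  rw [Set.ncard_eq_toFinset_card', Set.toFinset_ofPred, Finset.card_filter, Fintype.sum_sigma]
  refine Finset.sum_congr rfl fun i _ => ?_
  split_ifs <;> simp [*]

theorem exists_rat_lower {V : Type*} {s : Set V} (hs : s.Finite) (hne : s.Nonempty) (f : V → ℕ)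
    {N : ℕ} (hN : 0 < N) {x : ℝ} (h : ∀ v ∈ s, x * N ≤ f v) :
    ∃ p : ℚ, x ≤ p ∧ ∀ v ∈ s, p * N ≤ f v := by
  obtain ⟨v, hv, hmin⟩ := Set.exists_min_image s f hs hne
  refine ⟨f v / N, ?_, fun w hw => ?_⟩
  · push_cast
    rw [le_div_iff₀ (by positivity)]
    exact h v hv
  · rw [div_mul_cancel₀ _ (by positivity)]
    exact_mod_cast hmin w hw

theorem exists_rat_upper {V : Type*} {s : Set V} (hs : s.Finite) (hne : s.Nonempty) (f : V → ℕ)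
    {N : ℕ} (hN : 0 < N) {z : ℝ} (h : ∀ v ∈ s, f v < z * N) :
    ∃ r : ℚ, r < z ∧ ∀ v ∈ s, f v ≤ r * N := by
  obtain ⟨v, hv, hmax⟩ := Set.exists_max_image s f hs hne
  refine ⟨f v / N, ?_, fun w hw => ?_⟩
  · push_cast
    rw [div_lt_iff₀ (by positivity)]
    exact h v hv
  · rw [div_mul_cancel₀ _ (by positivity)]
    exact_mod_cast hmax w hw

theorem sum_indicator_ncard {V : Type*} [Fintype V] (s : Set V)
    (P : V → Prop) [DecidablePred P] (p : ℚ) :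
    ∑ j, ((if P j then 1 else 0) - p) * s.indicator 1 j =
      ({j ∈ s | P j}.ncard : ℚ) - p * s.ncard := by
  classical
  have hP : ({j ∈ s | P j}.ncard : ℚ) = ∑ j, if j ∈ s then if P j then 1 else 0 else 0 := by
    rw [Set.ncard_eq_toFinset_card', Set.toFinset_ofPred, ← Finset.sum_boole]
    simp only [ite_and]
  have hs : (s.ncard : ℚ) = ∑ j, if j ∈ s then 1 else 0 := by
    rw [Set.ncard_eq_toFinset_card', ← Set.filter_mem_univ_eq_toFinset, Finset.sum_boole]
  rw [hP, hs, Finset.mul_sum, ← Finset.sum_sub_distrib]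
  refine Finset.sum_congr rfl fun j _ => ?_
  by_cases hj : j ∈ s <;> simp [hj]

theorem le_ncard_blowup {V : Type*} [Fintype V] (n : V → ℕ) (P : V → Prop)
    [DecidablePred P] {p : ℚ} {x : ℝ}
    (hx : x ≤ p) (h : 0 ≤ ∑ i, (n i : ℚ) * ((if P i then 1 else 0) - p)) :
    x * Nat.card (Σ i, Fin (n i)) ≤ ({q : Σ i, Fin (n i) | P q.1}.ncard : ℝ) := by
  simp only [mul_sub, Finset.sum_sub_distrib, ← Finset.sum_mul, mul_ite, mul_one, mul_zero] at h
  have h' : ((∑ i, (n i : ℚ)) * p : ℚ) ≤ ∑ i, if P i then (n i : ℚ) else 0 := by linarith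
  have h'' : (∑ i, (n i : ℝ)) * p ≤ ∑ i, if P i then (n i : ℝ) else 0 := by exact_mod_cast h'
  rw [ncard_blowup, Nat.card_eq_fintype_card, Fintype.card_sigma]
  push_cast
  simp only [Fintype.card_fin]
  calc x * ∑ i, (n i : ℝ) ≤ p * ∑ i, (n i : ℝ) := by gcongr
    _ ≤ _ := by rwa [mul_comm]

theorem ncard_blowup_lt {V : Type*} [Fintype V] {n : V → ℕ} (hn : n ≠ 0) (P : V → Prop)
    [DecidablePred P] {r : ℚ} {z : ℝ} (hz : r < z) (h : 0 ≤ ∑ i, (n i : ℚ) * (r - if P i then 1 else 0)) :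
    ({q : Σ i, Fin (n i) | P q.1}.ncard : ℝ) < z * Nat.card (Σ i, Fin (n i)) := by
  simp only [mul_sub, Finset.sum_sub_distrib, ← Finset.sum_mul, mul_ite, mul_one, mul_zero] at h
  have h' : (∑ i, if P i then (n i : ℚ) else 0) ≤ ((∑ i, (n i : ℚ)) * r : ℚ) := by linarith
  have h'' : (∑ i, if P i then (n i : ℝ) else 0) ≤ (∑ i, (n i : ℝ)) * r := by exact_mod_cast h'
  have hpos : 0 < ∑ i, (n i : ℝ) := by
    obtain ⟨i, hi⟩ := Function.ne_iff.1 hn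
    exact Finset.sum_pos' (fun i _ => by positivity)
      ⟨i, Finset.mem_univ i, by exact_mod_cast Nat.pos_of_ne_zero hi⟩
  rw [ncard_blowup, Nat.card_eq_fintype_card, Fintype.card_sigma]
  push_cast
  simp only [Fintype.card_fin]
  calc _ ≤ (∑ i, (n i : ℝ)) * r := h''
    _ < z * ∑ i, (n i : ℝ) := by rw [mul_comm]; gcongr

theorem nonempty_blowup {V : Type*} {n : V → ℕ} (hn : n ≠ 0) : Nonempty (Σ i, Fin (n i)) := by
  obtain ⟨i, hi⟩ := Function.ne_iff.1 hn
  exact ⟨i, 0, Nat.pos_of_ne_zero hi⟩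

theorem indicator_one_ne_zero {V : Type*} {s : Set V} (hs : s.Nonempty) :
    s.indicator (1 : V → ℚ) ≠ 0 := by
  obtain ⟨v, hv⟩ := hs
  exact Function.ne_iff.2 ⟨v, by simp [hv]⟩

open Classical in
/-- The property defining the threshold for `(x,y)` follows from the one for `(y,x)`. -/
theorem exists_le_n2card_of_swap {x y z : ℝ}
    (h : ∀ (V : Type) [Fintype V] (G : SimpleGraph V) (A B C : Set V),
      Constrained G y x A B C → ∃ v ∈ C, z * A.ncard ≤ (n2card G v A : ℝ))
    (V : Type) [Fintype V] (G : SimpleGraph V) (A B C : Set V) (hG : Constrained G x y A B C) :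
    ∃ v ∈ C, z * A.ncard ≤ (n2card G v A : ℝ) := by
  by_contra! hlt
  obtain ⟨⟨hA, hB, hC, -, hAC, -, -, -, -, -⟩, hx, hy, hnadj⟩ := hG
  obtain ⟨p, hxp, hp⟩ := exists_rat_lower A.toFinite hA (fun v => nbrCard G v B)
    ((Set.ncard_pos B.toFinite).2 hB) hx
  obtain ⟨q, hyq, hq⟩ := exists_rat_lower B.toFinite hB (fun v => nbrCard G v C)
    ((Set.ncard_pos C.toFinite).2 hC) hy
  obtain ⟨r, hrz, hr⟩ := exists_rat_upper C.toFinite hC (fun v => n2card G v A)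
    ((Set.ncard_pos A.toFinite).2 hA) hlt
  obtain ⟨α, β, γ, hα, hβ, hγ, hK, hL, hM⟩ := cyclic_duality_nat
    (fun a b => (if G.Adj a b then 1 else 0) - p) (fun b c => (if G.Adj b c then 1 else 0) - q)
    (fun c a => r - if ∃ b, G.Adj c b ∧ G.Adj b a then 1 else 0)
    ⟨A.indicator 1, B.indicator 1, C.indicator 1,
      Set.indicator_nonneg fun _ _ => zero_le_one, indicator_one_ne_zero hA,
      Set.indicator_nonneg fun _ _ => zero_le_one, indicator_one_ne_zero hB,
      Set.indicator_nonneg fun _ _ => zero_le_one, indicator_one_ne_zero hC, by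
        intro a ha
        rw [sum_indicator_ncard, sub_nonneg]
        exact hp a (Set.mem_of_indicator_ne_zero ha), by
        intro b hb
        rw [sum_indicator_ncard, sub_nonneg]
        exact hq b (Set.mem_of_indicator_ne_zero hb), by
        intro c hc
        have hcC := Set.mem_of_indicator_ne_zero hc
        have hN : {a ∈ A | ∃ b, G.Adj c b ∧ G.Adj b a} = N2 G c ∩ A := by
          ext a
          constructor
          · rintro ⟨ha, hb⟩
            exact ⟨⟨fun hca => hnadj a ha c hcC hca.symm,
              fun hca => hAC.notMem_of_mem_left ha (hca ▸ hcC), hb⟩, ha⟩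
          · rintro ⟨⟨-, -, hb⟩, ha⟩
            exact ⟨ha, hb⟩
        have hsum := sum_indicator_ncard A (fun a => ∃ b, G.Adj c b ∧ G.Adj b a) r
        rw [hN] at hsum
        have := hr c hcC
        simp only [n2card] at this
        rw [← neg_nonpos, ← Finset.sum_neg_distrib]
        simp only [← neg_mul, neg_sub]
        rw [hsum]
        exact sub_nonpos.2 this⟩
  have := nonempty_blowup hα
  have := nonempty_blowup hβ
  have := nonempty_blowup hγ
  let R : (Σ i, Fin (γ i)) → (Σ i, Fin (β i)) → Prop := fun c b => G.Adj b.1 c.1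
  let S : (Σ i, Fin (β i)) → (Σ i, Fin (α i)) → Prop := fun b a => G.Adj a.1 b.1
  obtain ⟨_, ⟨a, rfl⟩, ha⟩ := h _ _ _ _ _ (constrained_tripartiteGraph R S (x := y) (y := x)
    (fun c => le_ncard_blowup β (fun b => G.Adj b c.1) hyq (hL c.1 c.2.pos.ne'))
    (fun b => le_ncard_blowup α (fun a => G.Adj a b.1) hxp (hK b.1 b.2.pos.ne')))
  rw [Set.ncard_range_of_injective Sum.inl_injective, Function.comp_apply,
    n2card_tripartiteGraph] at ha
  have hsub : {c | ∃ b, R c b ∧ S b a} ⊆ {c | ∃ b, G.Adj c.1 b ∧ G.Adj b a.1} :=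
    fun c ⟨b, hR, hS⟩ => ⟨b.1, hR.symm, hS.symm⟩
  refine (ha.trans ?_).not_gt (ncard_blowup_lt hγ (fun c => ∃ b, G.Adj c b ∧ G.Adj b a.1) hrz
    (hM a.1 a.2.pos.ne'))
  exact_mod_cast Set.ncard_le_ncard hsub (Set.toFinite _)

theorem stmt_5 (x y z : ℝ) (hx : x ∈ Set.Ioc (0:ℝ) 1) (hy : y ∈ Set.Ioc (0:ℝ) 1)
    (hz : z ∈ Set.Ioc (0:ℝ) 1) :
    (∀ (V : Type) [Fintype V] (G : SimpleGraph V) (A B C : Set V),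
        Constrained G x y A B C → ∃ v ∈ C, z * A.ncard ≤ (n2card G v A : ℝ)) ↔
    (∀ (V : Type) [Fintype V] (G : SimpleGraph V) (A B C : Set V),
        Constrained G y x A B C → ∃ v ∈ C, z * A.ncard ≤ (n2card G v A : ℝ)) :=
  ⟨fun h V _ => exists_le_n2card_of_swap h V, fun h V _ => exists_le_n2card_of_swap h V⟩
end

section
/- Let k > 0 be an integer, and let x, y ∈ (0,1] with x + (k+1)y ≤ 1 and (k+1)x + y ≤ 1, with strict inequality in both if x or y is irrational. Then there exists a graph G that is (x,y)-biconstrained via a tripartition (A,B,C) such that |N²_A(v)| < |A|/(k+1) for every vertex v ∈ C. (Equivalently, ψ(x,y) < 1/(k+1).) -/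
open Set

/-- The graph on `α ⊕ β ⊕ γ` whose edges are given by a relation between `α` and `β` and
a relation between `β` and `γ`. -/
def layeredGraph {α β γ : Type*} (R : α → β → Prop) (S : β → γ → Prop) :
    SimpleGraph (α ⊕ β ⊕ γ) where
  Adj
    | .inl a, .inr (.inl b) => R a b
    | .inr (.inl b), .inl a => R a b
    | .inr (.inl b), .inr (.inr c) => S b c
    | .inr (.inr c), .inr (.inl b) => S b c
    | _, _ => False
  symm := ⟨by rintro (a | b | c) (a' | b' | c') h <;> exact h⟩
  loopless := ⟨by rintro (a | b | c) h <;> exact h⟩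

/-- Degree bounds for two composable relations turn into a biconstrained layered graph. -/
theorem exists_biconstrained_of_relations {α β γ : Type} [Fintype α] [Fintype β] [Fintype γ]
    [Nonempty α] [Nonempty β] [Nonempty γ] (R : α → β → Prop) (S : β → γ → Prop) (x y z : ℝ)
    (hαβ : ∀ a, x * Fintype.card β ≤ ({b | R a b}.ncard : ℝ))
    (hβγ : ∀ b, y * Fintype.card γ ≤ ({c | S b c}.ncard : ℝ))
    (hβα : ∀ b, x * Fintype.card α ≤ ({a | R a b}.ncard : ℝ))
    (hγβ : ∀ c, y * Fintype.card β ≤ ({b | S b c}.ncard : ℝ))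
    (hγα : ∀ c, ({a | ∃ b, R a b ∧ S b c}.ncard : ℝ) < (Fintype.card α : ℝ) / z) :
    ∃ (V : Type) (_ : Fintype V) (G : SimpleGraph V) (A B C : Set V),
      Biconstrained G x y A B C ∧
      ∀ v ∈ C, (n2card G v A : ℝ) < (A.ncard : ℝ) / z := by
  have injβ : Function.Injective (fun b : β => (.inr (.inl b) : α ⊕ β ⊕ γ)) :=
    Sum.inr_injective.comp Sum.inl_injective
  have injγ : Function.Injective (fun c : γ => (.inr (.inr c) : α ⊕ β ⊕ γ)) :=
    Sum.inr_injective.comp Sum.inr_injective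
  have cα : (range (.inl : α → α ⊕ β ⊕ γ)).ncard = Fintype.card α := by
    rw [← image_univ, ncard_image_of_injective _ Sum.inl_injective, ncard_univ,
      Nat.card_eq_fintype_card]
  have cβ : (range (fun b : β => (.inr (.inl b) : α ⊕ β ⊕ γ))).ncard = Fintype.card β := by
    rw [← image_univ, ncard_image_of_injective _ injβ, ncard_univ, Nat.card_eq_fintype_card]
  have cγ : (range (fun c : γ => (.inr (.inr c) : α ⊕ β ⊕ γ))).ncard = Fintype.card γ := by
    rw [← image_univ, ncard_image_of_injective _ injγ, ncard_univ, Nat.card_eq_fintype_card]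
  refine ⟨α ⊕ β ⊕ γ, inferInstance, layeredGraph R S, range .inl,
    range (fun b => .inr (.inl b)), range (fun c => .inr (.inr c)),
    ⟨⟨⟨range_nonempty _, range_nonempty _, range_nonempty _, ?_, ?_, ?_, ?_, ?_, ?_, ?_⟩,
      ?_, ?_, ?_⟩, ?_, ?_⟩, ?_⟩
  · rw [Set.disjoint_left]; rintro _ ⟨a, rfl⟩ ⟨b, hb⟩; simp at hb
  · rw [Set.disjoint_left]; rintro _ ⟨a, rfl⟩ ⟨b, hb⟩; simp at hb
  · rw [Set.disjoint_left]; rintro _ ⟨a, rfl⟩ ⟨b, hb⟩; simp at hb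
  · ext (a | b | c) <;> simp
  · rintro _ ⟨a, rfl⟩ _ ⟨b, rfl⟩ h; exact h
  · rintro _ ⟨a, rfl⟩ _ ⟨b, rfl⟩ h; exact h
  · rintro _ ⟨a, rfl⟩ _ ⟨b, rfl⟩ h; exact h
  · rintro _ ⟨a, rfl⟩
    rw [cβ]
    refine (hαβ a).trans_eq ?_
    rw [nbrCard, ← ncard_image_of_injective _ injβ]
    congr 2
    ext (a' | b' | c') <;> simp [layeredGraph]
  · rintro _ ⟨b, rfl⟩
    rw [cγ]
    refine (hβγ b).trans_eq ?_
    rw [nbrCard, ← ncard_image_of_injective _ injγ]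
    congr 2
    ext (a' | b' | c') <;> simp [layeredGraph]
  · rintro _ ⟨a, rfl⟩ _ ⟨c, rfl⟩ h; exact h
  · rintro _ ⟨b, rfl⟩
    rw [cα]
    refine (hβα b).trans_eq ?_
    rw [nbrCard, ← ncard_image_of_injective _ Sum.inl_injective]
    congr 2
    ext (a' | b' | c') <;> simp [layeredGraph]
  · rintro _ ⟨c, rfl⟩
    rw [cβ]
    refine (hγβ c).trans_eq ?_
    rw [nbrCard, ← ncard_image_of_injective _ injβ]
    congr 2
    ext (a' | b' | c') <;> simp [layeredGraph]
  · rintro _ ⟨c, rfl⟩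
    rw [cα]
    refine lt_of_le_of_lt ?_ (hγα c)
    rw [n2card, ← ncard_image_of_injective {a | ∃ b, R a b ∧ S b c}
      (Sum.inl_injective (β := β ⊕ γ))]
    refine Nat.cast_le.2 (ncard_le_ncard ?_ (toFinite _))
    rintro _ ⟨⟨-, -, w, hw, hw'⟩, a, rfl⟩
    rcases w with a' | b | c'
    · exact hw.elim
    · exact ⟨a, ⟨b, hw', hw⟩, rfl⟩
    · exact hw.elim

theorem card_le_ncard_of_injective {σ τ : Type*} [Fintype σ] [Finite τ] {P : τ → Prop}
    (f : σ → τ) (hf : Function.Injective f) (hP : ∀ s, P (f s)) :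
    Fintype.card σ ≤ {t | P t}.ncard := by
  rw [← Nat.card_eq_fintype_card, ← ncard_univ, ← ncard_image_of_injective _ hf]
  refine ncard_le_ncard ?_ (toFinite _)
  rintro _ ⟨s, -, rfl⟩
  exact hP s

theorem ncard_le_card_of_subset_range {σ τ : Type*} [Fintype σ] {P : τ → Prop}
    (f : σ → τ) (hP : ∀ t, P t → t ∈ range f) :
    {t | P t}.ncard ≤ Fintype.card σ := by
  refine (ncard_le_ncard hP (finite_range f)).trans ?_
  rw [← image_univ, ← Nat.card_eq_fintype_card, ← ncard_univ]
  exact ncard_image_le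

/-- Block adjacency between the first two layers: `k` complete blocks, and a final block in
which the vertices of `Fin w` see everything and `s : ZMod N` misses a cyclic interval of
length `q`. -/
def blockRel (k u w m N q : ℕ) :
    (Fin k × Fin u) ⊕ (Fin w ⊕ ZMod N) → (Fin k × Fin m) ⊕ ZMod N → Prop
  | .inl a, .inl b => a.1 = b.1
  | .inr (.inl _), .inr _ => True
  | .inr (.inr s), .inr t => q ≤ (t - s).val
  | _, _ => False

/-- Block adjacency between the last two layers: `k` complete blocks, and a final block in
which `s : ZMod N` sees a cyclic interval of length `q`. -/
def intervalRel (k m N q : ℕ) :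
    (Fin k × Fin m) ⊕ ZMod N → (Fin k × Fin m) ⊕ ZMod N → Prop
  | .inl b, .inl c => b.1 = c.1
  | .inr t, .inr s => (t - s).val < q
  | _, _ => False

theorem natCast_zmod_injOn {N a b : ℕ} (ha : a < N) (hb : b < N)
    (h : (a : ZMod N) = b) : a = b := by
  rw [← ZMod.val_natCast_of_lt ha, ← ZMod.val_natCast_of_lt hb, h]

theorem exists_biconstrained_of_nat {k m p q n D : ℕ} {x y : ℝ} (hp : 0 < p)
    (hpm : p ≤ m) (hqm : q ≤ m) (hpq : p + q ≤ D + 1) (hq : 0 < q) (hn : k * m + (D + 1) = n)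
    (hx : x * n ≤ p) (hy : y * n ≤ q) :
    ∃ (V : Type) (_ : Fintype V) (G : SimpleGraph V) (A B C : Set V),
      Biconstrained G x y A B C ∧
      ∀ v ∈ C, (n2card G v A : ℝ) < (A.ncard : ℝ) / (k + 1) := by
  obtain ⟨w, hw⟩ : ∃ w, w = p * ((k + 1) * (D + 1) + 1) := ⟨_, rfl⟩
  have hB : Fintype.card ((Fin k × Fin m) ⊕ ZMod (D + 1)) = n := by
    simp [← hn, ZMod.card]
  have hA : Fintype.card ((Fin k × Fin (w + D)) ⊕ (Fin w ⊕ ZMod (D + 1))) =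
      (k + 1) * (w + D) + 1 := by
    simp only [Fintype.card_sum, Fintype.card_prod, Fintype.card_fin, ZMod.card]
    ring
  have hxA : x * Fintype.card ((Fin k × Fin (w + D)) ⊕ (Fin w ⊕ ZMod (D + 1))) ≤ w := by
    have hn0 : (0 : ℝ) < n := by rw [← hn]; positivity
    have key : p * ((k + 1) * (w + D) + 1) ≤ w * n := by
      have h1 : (k + 1) * p + 1 ≤ n := by nlinarith
      have h2 := Nat.mul_le_mul_left w h1
      have h3 : p * ((k + 1) * D + 1) ≤ w := by rw [hw]; gcongr; omega
      linarith
    have key' : (p : ℝ) * ((k + 1) * (w + D) + 1) ≤ w * n := by exact_mod_cast key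
    rw [hA]
    push_cast
    refine le_of_mul_le_mul_right ?_ hn0
    have : (0 : ℝ) ≤ (k + 1) * (w + D) + 1 := by positivity
    nlinarith [mul_le_mul_of_nonneg_right hx this]
  have : Nonempty ((Fin k × Fin (w + D)) ⊕ (Fin w ⊕ ZMod (D + 1))) := ⟨.inr (.inr 0)⟩
  have : Nonempty ((Fin k × Fin m) ⊕ ZMod (D + 1)) := ⟨.inr 0⟩
  apply exists_biconstrained_of_relations (blockRel k (w + D) w m (D + 1) q)
    (intervalRel k m (D + 1) q)
  · intro a
    rw [hB]
    refine hx.trans (Nat.cast_le.2 ?_)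
    rcases a with ⟨i, a⟩ | a | s
    · refine hpm.trans ?_
      simpa using card_le_ncard_of_injective (σ := Fin m)
        (P := fun b => blockRel k (w + D) w m (D + 1) q (.inl (i, a)) b)
        (fun r => .inl (i, r)) (fun r r' h => by simpa using h) (fun r => rfl)
    · refine (show p ≤ D + 1 by omega).trans ?_
      simpa [ZMod.card] using card_le_ncard_of_injective (σ := ZMod (D + 1))
        (P := fun b => blockRel k (w + D) w m (D + 1) q (.inr (.inl a)) b)
        .inr Sum.inr_injective (fun r => trivial)
    · have := card_le_ncard_of_injective (σ := Fin p)
        (P := fun b => blockRel k (w + D) w m (D + 1) q (.inr (.inr s)) b)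
        (fun r => .inr (s + ((q + r : ℕ) : ZMod (D + 1)))) (fun r r' h => by
          have h' := natCast_zmod_injOn (by omega) (by omega)
            (add_left_cancel (Sum.inr_injective h))
          exact Fin.ext (by omega)) (fun r => by
          change q ≤ (s + ((q + r : ℕ) : ZMod (D + 1)) - s).val
          rw [add_sub_cancel_left, ZMod.val_natCast_of_lt (by omega)]
          omega)
      simpa using this
  · intro b
    rw [hB]
    refine hy.trans (Nat.cast_le.2 ?_)
    rcases b with ⟨i, b⟩ | t
    · refine hqm.trans ?_
      simpa using card_le_ncard_of_injective (σ := Fin m)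
        (P := fun c => intervalRel k m (D + 1) q (.inl (i, b)) c)
        (fun r => .inl (i, r)) (fun r r' h => by simpa using h) (fun r => rfl)
    · have := card_le_ncard_of_injective (σ := Fin q)
        (P := fun c => intervalRel k m (D + 1) q (.inr t) c)
        (fun r => .inr (t - ((r : ℕ) : ZMod (D + 1)))) (fun r r' h => by
          exact Fin.ext (natCast_zmod_injOn (by omega) (by omega)
            (sub_right_injective (Sum.inr_injective h)))) (fun r => by
          change (t - (t - ((r : ℕ) : ZMod (D + 1)))).val < q
          rw [sub_sub_cancel, ZMod.val_natCast_of_lt (by omega)]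
          omega)
      simpa using this
  · intro b
    refine hxA.trans (Nat.cast_le.2 ?_)
    rcases b with ⟨i, b⟩ | t
    · refine (Nat.le_add_right w D).trans ?_
      simpa using card_le_ncard_of_injective (σ := Fin (w + D))
        (P := fun a => blockRel k (w + D) w m (D + 1) q a (.inl (i, b)))
        (fun r => .inl (i, r)) (fun r r' h => by simpa using h) (fun r => rfl)
    · simpa using card_le_ncard_of_injective (σ := Fin w)
        (P := fun a => blockRel k (w + D) w m (D + 1) q a (.inr t))
        (fun r => .inr (.inl r)) (fun r r' h => by simpa using h) (fun r => trivial)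
  · intro c
    rw [hB]
    refine hy.trans (Nat.cast_le.2 ?_)
    rcases c with ⟨i, c⟩ | s
    · refine hqm.trans ?_
      simpa using card_le_ncard_of_injective (σ := Fin m)
        (P := fun b => intervalRel k m (D + 1) q b (.inl (i, c)))
        (fun r => .inl (i, r)) (fun r r' h => by simpa using h) (fun r => rfl)
    · have := card_le_ncard_of_injective (σ := Fin q)
        (P := fun b => intervalRel k m (D + 1) q b (.inr s))
        (fun r => .inr (s + ((r : ℕ) : ZMod (D + 1)))) (fun r r' h => by
          exact Fin.ext (natCast_zmod_injOn (by omega) (by omega)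
            (add_left_cancel (Sum.inr_injective h)))) (fun r => by
          change (s + ((r : ℕ) : ZMod (D + 1)) - s).val < q
          rw [add_sub_cancel_left, ZMod.val_natCast_of_lt (by omega)]
          omega)
      simpa using this
  · intro c
    suffices h : {a | ∃ b, blockRel k (w + D) w m (D + 1) q a b ∧
        intervalRel k m (D + 1) q b c}.ncard ≤ w + D by
      refine (Nat.cast_le.2 h).trans_lt ?_
      rw [hA, lt_div_iff₀ (by positivity)]
      push_cast
      linarith
    rcases c with ⟨i, c⟩ | s
    · refine (ncard_le_card_of_subset_range (σ := Fin (w + D)) (fun r => .inl (i, r)) ?_).trans_eq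
        (by simp)
      rintro (⟨j, a⟩ | a | s) ⟨⟨j', b⟩ | t, h, h'⟩
      · obtain rfl : j = j' := h
        obtain rfl : j = i := h'
        exact ⟨a, rfl⟩
      all_goals first | exact h.elim | exact h'.elim
    · refine (ncard_le_card_of_subset_range (σ := Fin w ⊕ {t : ZMod (D + 1) // t ≠ s})
        (Sum.elim (fun r => .inr (.inl r)) (fun t => .inr (.inr t.1))) ?_).trans_eq
        (by simp [ZMod.card, Fintype.card_subtype_compl])
      rintro (⟨j, a⟩ | a | s') ⟨⟨j', b⟩ | t, h, h'⟩
      · exact h'.elim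
      · exact h.elim
      · exact h.elim
      · exact ⟨.inl a, rfl⟩
      · exact h.elim
      · refine ⟨.inr ⟨s', ?_⟩, rfl⟩
        rintro rfl
        exact absurd (show (t - s').val < q from h') (not_lt.2 h)

/-- Points of the region can be moved up to rational points of the region. -/
theorem exists_rat_ge_of_region (k : ℕ) {x y : ℝ}
    (h1 : x + (k + 1) * y ≤ 1) (h2 : ((k : ℝ) + 1) * x + y ≤ 1)
    (hstrict : Irrational x ∨ Irrational y →
      x + (k + 1) * y < 1 ∧ ((k : ℝ) + 1) * x + y < 1) :
    ∃ a b : ℚ, x ≤ a ∧ y ≤ b ∧ a + (k + 1) * b ≤ 1 ∧ ((k : ℚ) + 1) * a + b ≤ 1 := by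
  by_cases h : Irrational x ∨ Irrational y
  · obtain ⟨h1, h2⟩ := hstrict h
    obtain ⟨e, he0, he1, he2⟩ : ∃ e : ℝ, 0 < e ∧ (k + 2) * e ≤ 1 - (x + (k + 1) * y) ∧
        (k + 2) * e ≤ 1 - ((k + 1) * x + y) := by
      have hk : (0 : ℝ) < k + 2 := by positivity
      refine ⟨min (1 - (x + (k + 1) * y)) (1 - ((k + 1) * x + y)) / (k + 2),
        div_pos (lt_min (by linarith) (by linarith)) hk, ?_, ?_⟩ <;>
      rw [mul_div_cancel₀ _ hk.ne']
      · exact min_le_left _ _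
      · exact min_le_right _ _
    obtain ⟨a, ha, ha'⟩ := exists_rat_btwn (show x < x + e by linarith)
    obtain ⟨b, hb, hb'⟩ := exists_rat_btwn (show y < y + e by linarith)
    have hk : (0 : ℝ) ≤ k := by positivity
    refine ⟨a, b, ha.le, hb.le, ?_, ?_⟩
    · have : (a : ℝ) + (k + 1) * b ≤ 1 := by nlinarith
      exact_mod_cast this
    · have : ((k : ℝ) + 1) * a + b ≤ 1 := by nlinarith
      exact_mod_cast this
  · simp only [Irrational, not_or, not_not] at h
    obtain ⟨⟨a, rfl⟩, ⟨b, rfl⟩⟩ := h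
    exact ⟨a, b, le_rfl, le_rfl, by exact_mod_cast h1, by exact_mod_cast h2⟩

/-- Two nonnegative rationals have a common denominator. -/
theorem exists_common_den {a b : ℚ} (ha : 0 ≤ a) (hb : 0 ≤ b) :
    ∃ p q n : ℕ, 0 < n ∧ a * n = p ∧ b * n = q := by
  lift a to ℚ≥0 using ha
  lift b to ℚ≥0 using hb
  refine ⟨a.num * b.den, b.num * a.den, a.den * b.den,
    Nat.mul_pos a.den_pos b.den_pos, ?_, ?_⟩
  · have := NNRat.mul_den_eq_num a
    push_cast
    rw [← mul_assoc]
    congr 1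
    exact_mod_cast this
  · have := NNRat.mul_den_eq_num b
    push_cast
    rw [mul_comm (a.den : ℚ), ← mul_assoc]
    congr 1
    exact_mod_cast this

theorem stmt_7 (k : ℕ) (hk : 0 < k) (x y : ℝ)
    (hx : x ∈ Set.Ioc (0:ℝ) 1) (hy : y ∈ Set.Ioc (0:ℝ) 1)
    (h1 : x + (k + 1) * y ≤ 1) (h2 : ((k : ℝ) + 1) * x + y ≤ 1)
    (hstrict : Irrational x ∨ Irrational y →
      x + (k + 1) * y < 1 ∧ ((k : ℝ) + 1) * x + y < 1) :
    ∃ (V : Type) (_ : Fintype V) (G : SimpleGraph V) (A B C : Set V),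
      Biconstrained G x y A B C ∧
      ∀ v ∈ C, (n2card G v A : ℝ) < (A.ncard : ℝ) / (k + 1) := by
  obtain ⟨a, b, hxa, hyb, hab1, hab2⟩ := exists_rat_ge_of_region k h1 h2 hstrict
  have ha : 0 < a := by exact_mod_cast hx.1.trans_le hxa
  have hb : 0 < b := by exact_mod_cast hy.1.trans_le hyb
  obtain ⟨p, q, n, hn, hp, hq⟩ := exists_common_den ha.le hb.le
  have hn' : (0 : ℚ) < n := by exact_mod_cast hn
  have hp0 : 0 < p := by exact_mod_cast hp ▸ mul_pos ha hn'
  have hq0 : 0 < q := by exact_mod_cast hq ▸ mul_pos hb hn'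
  have hpq1 : p + (k + 1) * q ≤ n := by
    have : (p : ℚ) + (k + 1) * q ≤ n := by rw [← hp, ← hq]; nlinarith
    exact_mod_cast this
  have hpq2 : (k + 1) * p + q ≤ n := by
    have : ((k : ℚ) + 1) * p + q ≤ n := by rw [← hp, ← hq]; nlinarith
    exact_mod_cast this
  have hmax : k * max p q + (p + q) ≤ n := by
    rcases max_choice p q with h | h <;> rw [h] <;> linarith
  obtain ⟨d, rfl⟩ := Nat.exists_eq_add_of_le hmax
  refine exists_biconstrained_of_nat (m := max p q)
    (n := k * max p q + (p + q) + d) (D := p + q + d - 1) hp0 (le_max_left p q)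
    (le_max_right p q) (by omega) hq0 (by omega) ?_ ?_
  · have hp' : (a : ℝ) * (k * max p q + (p + q) + d : ℕ) = p := by exact_mod_cast hp
    rw [← hp']
    gcongr
  · have hq' : (b : ℝ) * (k * max p q + (p + q) + d : ℕ) = q := by exact_mod_cast hq
    rw [← hq']
    gcongr
end

section
/- Let x ∈ (0,1] and let k ≥ 1 be the largest integer with 1/k ≥ x (that is, 1/(k+1) < x ≤ 1/k). Then: (a) every graph G that is (x,x)-biconstrained via a tripartition (A,B,C) contains a vertex v ∈ C with |N²_A(v)| ≥ |A|/k; and (b) for every real z > 1/k, there exists a graph G that is (x,x)-biconstrained via a tripartition (A,B,C) with |N²_A(v)| < z·|A| for every vertex v ∈ C. (That is, ψ(x,x) = 1/k.) -/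
open Set

section DoubleCounting

variable {V : Type*} [DecidableEq V] (G : SimpleGraph V) [DecidableRel G.Adj]

/-- The vertices of `A` joined to `c` by a two-edge path through `B`. -/
def twoStep (A B : Finset V) (c : V) : Finset V :=
  A.filter fun a => ∃ b ∈ B, G.Adj c b ∧ G.Adj b a

/-- Some family of vertices of `C` with pairwise disjoint neighbourhoods in `B` is such that
every vertex of `C` shares a neighbour in `B` with a member of the family. -/
lemma exists_maximal_disjoint_nbhds (B C : Finset V)
    (hC : ∀ c ∈ C, (B.filter (G.Adj c)).Nonempty) :
    ∃ T ⊆ C, (T : Set V).PairwiseDisjoint (fun c => B.filter (G.Adj c)) ∧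
      ∀ c ∈ C, ∃ t ∈ T, ∃ b ∈ B, G.Adj c b ∧ G.Adj t b := by
  classical
  let F : Finset (Finset V) := C.powerset.filter fun T =>
    (T : Set V).PairwiseDisjoint fun c => B.filter (G.Adj c)
  obtain ⟨T, hTF, hmax⟩ := F.exists_max_image Finset.card ⟨∅, by simp [F]⟩
  obtain ⟨hTC, hT⟩ : T ⊆ C ∧ (T : Set V).PairwiseDisjoint (fun c => B.filter (G.Adj c)) := by
    simpa [F] using hTF
  refine ⟨T, hTC, hT, fun c hc => ?_⟩
  by_contra! hno
  have hcT : c ∉ T := fun h => by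
    obtain ⟨b, hb⟩ := hC c hc
    rw [Finset.mem_filter] at hb
    exact hno c h b hb.1 hb.2 hb.2
  have hins : insert c T ∈ F := by
    simp only [F, Finset.mem_filter, Finset.mem_powerset, Finset.coe_insert]
    refine ⟨Finset.insert_subset hc hTC, hT.insert fun t ht _ => ?_⟩
    rw [Finset.disjoint_left]
    intro b hb hb'
    rw [Finset.mem_filter] at hb hb'
    exact hno t ht b hb.1 hb.2 hb'.2
  have := hmax _ hins
  rw [Finset.card_insert_of_notMem hcT] at this
  omega

lemma exists_card_div_le_card_twoStep (A B C : Finset V) (x : ℝ) (k : ℕ)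
    (hx : 0 < x) (hk : 1 ≤ k) (hxk : 1 < x * (k + 1))
    (hA : A.Nonempty) (hB : B.Nonempty) (hC : C.Nonempty)
    (hAB : ∀ a ∈ A, x * B.card ≤ (B.filter (G.Adj a)).card)
    (hBC : ∀ b ∈ B, x * C.card ≤ (C.filter (G.Adj b)).card)
    (hBA : ∀ b ∈ B, x * A.card ≤ (A.filter (G.Adj b)).card)
    (hCB : ∀ c ∈ C, x * B.card ≤ (B.filter (G.Adj c)).card) :
    ∃ c ∈ C, (A.card : ℝ) / k ≤ (twoStep G A B c).card := by
  by_contra! hlt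
  have hA0 : (0 : ℝ) < A.card := by exact_mod_cast hA.card_pos
  have hB0 : (0 : ℝ) < B.card := by exact_mod_cast hB.card_pos
  have hC0 : (0 : ℝ) < C.card := by exact_mod_cast hC.card_pos
  have hk0 : (0 : ℝ) < k := by exact_mod_cast hk
  have hCne : ∀ c ∈ C, (B.filter (G.Adj c)).Nonempty := fun c hc => by
    have h : (0 : ℝ) < (B.filter (G.Adj c)).card := (mul_pos hx hB0).trans_le (hCB c hc)
    exact Finset.card_pos.mp (by exact_mod_cast h)
  obtain ⟨T, hTC, hTdisj, hTmax⟩ := exists_maximal_disjoint_nbhds G B C hCne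
  have hTne : T.Nonempty := by
    obtain ⟨c, hc⟩ := hC
    obtain ⟨t, ht, -⟩ := hTmax c hc
    exact ⟨t, ht⟩
  set W := T.biUnion fun c => B.filter (G.Adj c) with hW
  set U := T.biUnion (twoStep G A B) with hU
  have hWB : W ⊆ B := Finset.biUnion_subset.mpr fun c _ => Finset.filter_subset _ _
  have hWcard : (T.card : ℝ) * (x * B.card) ≤ W.card := by
    rw [hW, Finset.card_biUnion hTdisj, Nat.cast_sum, ← nsmul_eq_mul]
    exact Finset.card_nsmul_le_sum _ _ _ fun c hc => hCB c (hTC hc)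
  have hUcard : (U.card : ℝ) < T.card * (A.card / k) := by
    calc (U.card : ℝ) ≤ ∑ c ∈ T, ((twoStep G A B c).card : ℝ) := by
          exact_mod_cast Finset.card_biUnion_le
      _ < ∑ c ∈ T, (A.card : ℝ) / k := Finset.sum_lt_sum_of_nonempty hTne fun c hc => hlt c (hTC hc)
      _ = T.card * (A.card / k) := by rw [Finset.sum_const, nsmul_eq_mul]
  have hWle : (W.card : ℝ) ≤ B.card := by exact_mod_cast Finset.card_le_card hWB
  have hTk : T.card ≤ k := by
    by_contra! h
    have h' : (k : ℝ) + 1 ≤ T.card := by exact_mod_cast h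
    nlinarith [mul_le_mul_of_nonneg_right h' (mul_pos hx hB0).le, mul_lt_mul_of_pos_right hxk hB0]
  rcases hTk.eq_or_lt with hTk | hTk
  · have hAU : A ⊆ U := by
      intro a ha
      by_contra haU
      have hdisj : Disjoint W (B.filter (G.Adj a)) := by
        rw [Finset.disjoint_left]
        intro b hbW hba
        rw [Finset.mem_filter] at hba
        obtain ⟨c, hc, hbc⟩ := Finset.mem_biUnion.mp hbW
        exact haU (Finset.mem_biUnion.mpr ⟨c, hc, Finset.mem_filter.mpr
          ⟨ha, b, hba.1, (Finset.mem_filter.mp hbc).2, hba.2.symm⟩⟩)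
      have hle : W.card + (B.filter (G.Adj a)).card ≤ B.card := by
        rw [← Finset.card_union_of_disjoint hdisj]
        exact Finset.card_le_card (Finset.union_subset hWB (Finset.filter_subset _ _))
      have hle' : (W.card : ℝ) + (B.filter (G.Adj a)).card ≤ B.card := by exact_mod_cast hle
      rw [hTk] at hWcard
      nlinarith [hAB a ha, mul_lt_mul_of_pos_right hxk hB0]
    have hle : (A.card : ℝ) ≤ U.card := by exact_mod_cast Finset.card_le_card hAU
    rw [hTk, mul_div_cancel₀ _ hk0.ne'] at hUcard
    linarith
  · have hTk' : (T.card : ℝ) ≤ k - 1 := by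
      rw [le_sub_iff_add_le]
      exact_mod_cast hTk
    have hcount : ∑ a ∈ A \ U, ((C.filter fun c => a ∈ twoStep G A B c).card : ℝ) =
        ∑ c ∈ C, (((A \ U).filter fun a => a ∈ twoStep G A B c).card : ℝ) := by
      exact_mod_cast Finset.sum_card_bipartiteAbove_eq_sum_card_bipartiteBelow
        (fun a c => a ∈ twoStep G A B c)
    have hlower : ((A \ U).card : ℝ) * (x * C.card) ≤
        ∑ a ∈ A \ U, ((C.filter fun c => a ∈ twoStep G A B c).card : ℝ) := by
      rw [← nsmul_eq_mul]
      refine Finset.card_nsmul_le_sum _ _ _ fun a ha => ?_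
      have haA := (Finset.mem_sdiff.mp ha).1
      have h : (0 : ℝ) < (B.filter (G.Adj a)).card := (mul_pos hx hB0).trans_le (hAB a haA)
      obtain ⟨b, hb⟩ := Finset.card_pos.mp (by exact_mod_cast h)
      rw [Finset.mem_filter] at hb
      refine (hBC b hb.1).trans ?_
      norm_cast
      refine Finset.card_le_card fun c hc => ?_
      rw [Finset.mem_filter] at hc ⊢
      exact ⟨hc.1, Finset.mem_filter.mpr ⟨haA, b, hb.1, hc.2.symm, hb.2.symm⟩⟩
    have hupper : ∑ c ∈ C, (((A \ U).filter fun a => a ∈ twoStep G A B c).card : ℝ) ≤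
        C.card * (A.card / k - x * A.card) := by
      rw [← nsmul_eq_mul]
      refine Finset.sum_le_card_nsmul _ _ _ fun c hc => ?_
      obtain ⟨t, ht, b, hb, hcb, htb⟩ := hTmax c hc
      have hdisj : Disjoint ((A \ U).filter fun a => a ∈ twoStep G A B c)
          (A.filter (G.Adj b)) := by
        rw [Finset.disjoint_left]
        intro a ha hba
        rw [Finset.mem_filter, Finset.mem_sdiff] at ha
        rw [Finset.mem_filter] at hba
        exact ha.1.2 (Finset.mem_biUnion.mpr ⟨t, ht, Finset.mem_filter.mpr
          ⟨hba.1, b, hb, htb, hba.2⟩⟩)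
      have hle : ((A \ U).filter fun a => a ∈ twoStep G A B c).card +
          (A.filter (G.Adj b)).card ≤ (twoStep G A B c).card := by
        rw [← Finset.card_union_of_disjoint hdisj]
        refine Finset.card_le_card (Finset.union_subset (fun a ha => (Finset.mem_filter.mp ha).2)
          fun a ha => ?_)
        rw [Finset.mem_filter] at ha
        exact Finset.mem_filter.mpr ⟨ha.1, b, hb, hcb, ha.2⟩
      have hle' : (((A \ U).filter fun a => a ∈ twoStep G A B c).card : ℝ) +
          (A.filter (G.Adj b)).card ≤ (twoStep G A B c).card := by exact_mod_cast hle
      linarith [hlt c hc, hBA b hb]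
    have hAU : (A.card : ℝ) ≤ (A \ U).card + U.card := by
      exact_mod_cast Finset.card_le_card_sdiff_add_card
    have hAk : (k : ℝ) * (A.card / k) = A.card := mul_div_cancel₀ _ hk0.ne'
    have hAk0 : (0 : ℝ) < A.card / k := div_pos hA0 hk0
    set q : ℝ := A.card / k
    have hsdiff : q ≤ (A \ U).card := by nlinarith
    have hq : q * (x * C.card) ≤ C.card * (q - x * A.card) := by
      refine le_trans ?_ (hlower.trans (hcount.trans_le hupper))
      exact mul_le_mul_of_nonneg_right hsdiff (by positivity)
    rw [← hAk] at hq
    have : 0 < (C.card * q) * (x * (k + 1) - 1) := by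
      have := sub_pos.mpr hxk
      positivity
    nlinarith

end DoubleCounting

lemma exists_large_n2card {V : Type*} [Fintype V] (G : SimpleGraph V) (A B C : Set V) (x : ℝ)
    (k : ℕ) (hx : 0 < x) (hk : 1 ≤ k) (hxk : 1 < x * (k + 1)) (h : Biconstrained G x x A B C) :
    ∃ v ∈ C, (A.ncard : ℝ) / k ≤ (n2card G v A : ℝ) := by
  classical
  obtain ⟨⟨⟨hA, hB, hC, -, hAC, -, -, -, -, -⟩, hAB, hBC, hnAC⟩, hBA, hCB⟩ := h
  have hnbr (v : V) (S : Set V) : nbrCard G v S = (S.toFinset.filter (G.Adj v)).card := by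
    rw [nbrCard, ← Set.ncard_coe_finset]
    congr 1
    ext
    simp
  simp only [hnbr, Set.ncard_eq_toFinset_card'] at *
  obtain ⟨c, hc, hle⟩ := exists_card_div_le_card_twoStep G A.toFinset B.toFinset C.toFinset x k
    hx hk hxk (by simpa) (by simpa) (by simpa) (by simpa using hAB) (by simpa using hBC)
    (by simpa using hBA) (by simpa using hCB)
  rw [Set.mem_toFinset] at hc
  refine ⟨c, hc, hle.trans ?_⟩
  rw [Nat.cast_le, n2card, ← Set.ncard_coe_finset]
  refine Set.ncard_le_ncard (fun a ha => ?_) (Set.toFinite (N2 G c ∩ A))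
  simp only [twoStep, Finset.coe_filter, Set.mem_toFinset, Set.mem_ofPred_eq] at ha
  obtain ⟨haA, b, -, hcb, hba⟩ := ha
  exact ⟨⟨fun hca => hnAC a haA c hc hca.symm,
    fun hca => Set.disjoint_left.mp hAC haA (hca ▸ hc), b, hcb, hba⟩, haA⟩

/-- The disjoint union of `k` paths on three vertices. -/
def disjointPaths (k : ℕ) : SimpleGraph (Fin k × Fin 3) where
  Adj p q := p.1 = q.1 ∧ (p.2.val + 1 = q.2.val ∨ q.2.val + 1 = p.2.val)
  symm := ⟨fun _ _ h => ⟨h.1.symm, h.2.symm⟩⟩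
  loopless := ⟨fun _ h => by omega⟩

lemma ncard_layer (k : ℕ) (j : Fin 3) : {p : Fin k × Fin 3 | p.2 = j}.ncard = k := by
  have h : {p : Fin k × Fin 3 | p.2 = j} = Set.range fun i : Fin k => (i, j) := by
    ext ⟨i, l⟩
    simp [eq_comm]
  rw [h, ← Nat.card_coe_set_eq, Nat.card_range_of_injective fun _ _ h => (Prod.ext_iff.mp h).1,
    Nat.card_fin]

lemma one_le_nbrCard_disjointPaths {k : ℕ} (v : Fin k × Fin 3) (j : Fin 3)
    (h : v.2.val + 1 = j.val ∨ j.val + 1 = v.2.val) :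
    1 ≤ nbrCard (disjointPaths k) v {p | p.2 = j} :=
  (Set.ncard_pos (Set.toFinite _)).mpr ⟨(v.1, j), rfl, rfl, h⟩

lemma biconstrained_disjointPaths {k : ℕ} (hk : 1 ≤ k) {x : ℝ} (hx : x * k ≤ 1) :
    Biconstrained (disjointPaths k) x x {p | p.2 = 0} {p | p.2 = 1} {p | p.2 = 2} := by
  have hne (j : Fin 3) : {p : Fin k × Fin 3 | p.2 = j}.Nonempty := ⟨(⟨0, hk⟩, j), rfl⟩
  have hdisj {i j : Fin 3} (hij : i ≠ j) :
      Disjoint {p : Fin k × Fin 3 | p.2 = i} {p | p.2 = j} :=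
    Set.disjoint_left.mpr fun p hi hj => hij (hi.symm.trans hj)
  have hstable (j : Fin 3) : StableSet (disjointPaths k) {p | p.2 = j} := by
    rintro u rfl v hv ⟨-, h⟩
    rw [Set.mem_ofPred_eq] at hv
    rw [hv] at h
    omega
  have hdeg (v : Fin k × Fin 3) (j : Fin 3) (h : v.2.val + 1 = j.val ∨ j.val + 1 = v.2.val) (l) :
      x * {p : Fin k × Fin 3 | p.2 = l}.ncard ≤ nbrCard (disjointPaths k) v {p | p.2 = j} := by
    rw [ncard_layer]
    exact hx.trans (by exact_mod_cast one_le_nbrCard_disjointPaths v j h)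
  refine ⟨⟨⟨hne 0, hne 1, hne 2, hdisj (by decide), hdisj (by decide), hdisj (by decide), ?_,
    hstable 0, hstable 1, hstable 2⟩, ?_, ?_, ?_⟩, ?_, ?_⟩
  · ext ⟨i, j⟩
    fin_cases j <;> simp
  · exact fun v hv => hdeg v 1 (by rw [show v.2 = 0 from hv]; decide) 1
  · exact fun v hv => hdeg v 2 (by rw [show v.2 = 1 from hv]; decide) 2
  · rintro u hu v hv ⟨-, h⟩
    rw [show u.2 = 0 from hu, show v.2 = 2 from hv] at h
    revert h
    decide
  · exact fun v hv => hdeg v 0 (by rw [show v.2 = 1 from hv]; decide) 0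
  · exact fun v hv => hdeg v 1 (by rw [show v.2 = 2 from hv]; decide) 1

lemma n2card_disjointPaths_le_one {k : ℕ} (v : Fin k × Fin 3) (j : Fin 3) :
    n2card (disjointPaths k) v {p | p.2 = j} ≤ 1 := by
  refine (Set.ncard_le_one_iff (Set.toFinite _)).mpr ?_
  rintro p q ⟨⟨-, -, w, h₁, h₂⟩, hp⟩ ⟨⟨-, -, w', h₁', h₂'⟩, hq⟩
  exact Prod.ext (h₂.1.symm.trans (h₁.1.symm.trans (h₁'.1.trans h₂'.1))) (hp.trans hq.symm)

theorem stmt_10 (x : ℝ) (hx : x ∈ Set.Ioc (0:ℝ) 1) (k : ℕ) (hk : 1 ≤ k)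
    (h1 : 1 / ((k : ℝ) + 1) < x) (h2 : x ≤ 1 / (k : ℝ)) :
    (∀ (V : Type) [Fintype V] (G : SimpleGraph V) (A B C : Set V),
        Biconstrained G x x A B C →
        ∃ v ∈ C, (A.ncard : ℝ) / k ≤ (n2card G v A : ℝ)) ∧
    (∀ z : ℝ, 1 / (k : ℝ) < z →
      ∃ (V : Type) (_ : Fintype V) (G : SimpleGraph V) (A B C : Set V),
        Biconstrained G x x A B C ∧
        ∀ v ∈ C, (n2card G v A : ℝ) < z * A.ncard) := by
  have hk0 : (0 : ℝ) < k := by exact_mod_cast hk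
  refine ⟨fun V _ G A B C h => exists_large_n2card G A B C x k hx.1 hk
    ((div_lt_iff₀ (by positivity)).mp h1) h, fun z hz => ?_⟩
  refine ⟨Fin k × Fin 3, inferInstance, disjointPaths k, {p | p.2 = 0}, {p | p.2 = 1},
    {p | p.2 = 2}, biconstrained_disjointPaths hk ((le_div_iff₀ hk0).mp h2), fun v _ => ?_⟩
  rw [ncard_layer]
  refine lt_of_le_of_lt ?_ ((div_lt_iff₀ hk0).mp hz)
  exact_mod_cast n2card_disjointPaths_le_one v 0
end

section
/- Let k ≥ 1 be an integer, and let x, y ∈ (0,1] with y ≥ (k−1)/k² and kx + y > 1. Let G be a graph that is (x,y)-constrained via a tripartition (A,B,C), such that in addition every vertex in C has at least y|B| neighbours in B. Then there is a vertex v ∈ C with |N²_A(v)| ≥ |A|/k. (Consequently ψ(x,y) ≥ 1/k.) -/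
open Set

open Finset in
/-- **Turán's theorem**, in complementary form: if a reflexive symmetric relation `H` on a finite set
`S` admits no `r + 1` pairwise unrelated elements, then at least `#S ^ 2 / r` ordered pairs of
elements of `S` are related. -/
lemma sq_card_le_mul_sum_card_related {α : Type*} [DecidableEq α] (H : α → α → Prop)
    [DecidableRel H] (symm : ∀ a b, H a b → H b a) (r : ℕ) (S : Finset α)
    (refl : ∀ a ∈ S, H a a)
    (indep : ∀ T ⊆ S, #T = r + 1 → ∃ a ∈ T, ∃ b ∈ T, a ≠ b ∧ H a b) :
    #S ^ 2 ≤ r * ∑ a ∈ S, #{b ∈ S | H a b} := by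
  induction r generalizing S with
  | zero =>
    obtain rfl | ⟨u, hu⟩ := S.eq_empty_or_nonempty
    · simp
    · obtain ⟨a, ha, b, hb, hab, -⟩ := indep {u} (by simpa using hu) (by simp)
      simp_all
  | succ r ih =>
    obtain rfl | hS := S.eq_empty_or_nonempty
    · simp
    obtain ⟨u, hu, hmin⟩ := S.exists_min_image (fun a ↦ #{b ∈ S | H a b}) hS
    set N := {b ∈ S | H u b}
    set M := {b ∈ S | ¬ H u b} with hM
    have hMS : M ⊆ S := filter_subset _ _
    have huM : u ∉ M := by simp [hM, refl u hu]
    have ihM := ih M (fun a ha ↦ refl a (hMS ha)) fun T hT hcard ↦ by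
      have huT : u ∉ T := fun h ↦ huM (hT h)
      obtain ⟨a, ha, b, hb, hab, hHab⟩ := indep (insert u T)
        (insert_subset hu (hT.trans hMS)) (by rw [card_insert_of_notMem huT, hcard])
      have hTu : ∀ c ∈ T, ¬ H u c := fun c hc ↦ (mem_filter.mp (hT hc)).2
      rw [Finset.mem_insert] at ha hb
      rcases ha with rfl | ha <;> rcases hb with rfl | hb
      · exact absurd rfl hab
      · exact absurd hHab (hTu b hb)
      · exact absurd (symm _ _ hHab) (hTu a ha)
      · exact ⟨a, ha, b, hb, hab, hHab⟩
    have hcard : #N + #M = #S := card_filter_add_card_filter_not _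
    have hsum : #N * #N + ∑ a ∈ M, #{b ∈ M | H a b} ≤ ∑ a ∈ S, #{b ∈ S | H a b} := by
      rw [← sum_filter_add_sum_filter_not S (H u)]
      refine add_le_add ?_ (sum_le_sum fun a _ ↦ card_le_card (filter_subset_filter _ hMS))
      rw [← smul_eq_mul]
      exact card_nsmul_le_sum _ _ _ fun a ha ↦ hmin a (mem_filter.mp ha).1
    set P := ∑ a ∈ M, #{b ∈ M | H a b}
    rw [← hcard]
    refine le_trans ?_ (Nat.mul_le_mul_left _ hsum)
    obtain rfl | hr := r.eq_zero_or_pos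
    · have : #M = 0 := by simpa using ihM
      rw [this]
      nlinarith
    · refine Nat.le_of_mul_le_mul_left ?_ hr
      zify at ihM ⊢
      nlinarith [sq_nonneg ((#M : ℤ) - r * #N)]

open Finset in
/-- If every `c ∈ C` is related to fewer than `#A / k` elements of `A`, then the same holds for some
subset `A'` of `A` in which no `k` elements cover `C`. -/
lemma exists_subset_forall_card_eq_exists_not_rel {α γ : Type*} [DecidableEq α] (R : α → γ → Prop)
    [DecidableRel R] (k : ℕ) (hk : 1 ≤ k) (C : Finset γ) (A : Finset α)
    (hA : ∀ c ∈ C, k * #{a ∈ A | R a c} < #A) :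
    ∃ A' ⊆ A, (∀ c ∈ C, k * #{a ∈ A' | R a c} < #A') ∧
      ∀ T ⊆ A', #T = k → ∃ c ∈ C, ∀ a ∈ T, ¬ R a c := by
  induction A using Finset.strongInduction with
  | H A ih =>
    by_cases h : ∀ T ⊆ A, #T = k → ∃ c ∈ C, ∀ a ∈ T, ¬ R a c
    · exact ⟨A, Finset.Subset.refl A, hA, h⟩
    push Not at h
    obtain ⟨T, hTA, hTk, hT⟩ := h
    have hTne : T.Nonempty := card_pos.mp (by lia)
    obtain ⟨A', hA', hA'C, hA'T⟩ := ih (A \ T) (sdiff_ssubset hTA hTne) fun c hc ↦ by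
      obtain ⟨t, htT, ht⟩ := hT c hc
      have hlt : #{a ∈ A \ T | R a c} < #{a ∈ A | R a c} :=
        card_lt_card <| (filter_subset_filter _ sdiff_subset).ssubset_of_mem_notMem
          (mem_filter.mpr ⟨hTA htT, ht⟩) (by simp [htT])
      have := hA c hc
      have := card_sdiff_add_card_eq_card hTA
      nlinarith
    exact ⟨A', hA'.trans sdiff_subset, hA'C, hA'T⟩

open Finset in
/-- Let `H` be a reflexive symmetric relation on `A` such that `H`-related elements of `A` have many
common `R`-neighbours in `C`, and such that any `k` elements of `A` not covering `C` contain
an `H`-related pair. Then some `c ∈ C` is `R`-related to at least `#A / k` elements of `A`. -/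
lemma exists_card_le_mul_card_rel {α γ : Type*} [DecidableEq α] (R : α → γ → Prop)
    [DecidableRel R] (H : α → α → Prop) [DecidableRel H] (k : ℕ) (hk : 1 ≤ k) (y : ℝ)
    (hy : (k : ℝ) - 1 ≤ y * k ^ 2) (A : Finset α) (C : Finset γ) (hC : C.Nonempty)
    (refl : ∀ a ∈ A, H a a) (symm : ∀ a b, H a b → H b a)
    (common : ∀ a ∈ A, ∀ b ∈ A, H a b → y * #C ≤ #{c ∈ C | R a c ∧ R b c})
    (indep : ∀ T ⊆ A, #T = k → (∃ c ∈ C, ∀ a ∈ T, ¬ R a c) →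
      ∃ a ∈ T, ∃ b ∈ T, a ≠ b ∧ H a b) :
    ∃ c ∈ C, #A ≤ k * #{a ∈ A | R a c} := by
  by_contra! hA
  obtain ⟨S, hSA, hS, hT⟩ := exists_subset_forall_card_eq_exists_not_rel R k hk C A hA
  obtain ⟨r, rfl⟩ := Nat.exists_eq_add_of_le' hk
  have turan := sq_card_le_mul_sum_card_related H symm r S (fun a ha ↦ refl a (hSA ha))
    fun T hTS hTk ↦ indep T (hTS.trans hSA) hTk (hT T hTS hTk)
  set P := ∑ a ∈ S, #{b ∈ S | H a b}
  have count : ∑ c ∈ C, #{a ∈ S | R a c} ^ 2 = ∑ a ∈ S, ∑ b ∈ S, #{c ∈ C | R a c ∧ R b c} := by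
    simp_rw [card_filter, sq, sum_mul_sum, ite_zero_mul_ite_zero, mul_one]
    rw [sum_comm]
    exact sum_congr rfl fun a _ ↦ sum_comm
  have lower : y * #C * P ≤ ∑ c ∈ C, (#{a ∈ S | R a c} : ℝ) ^ 2 := by
    have : (∑ c ∈ C, (#{a ∈ S | R a c} : ℝ) ^ 2) =
        ∑ a ∈ S, ∑ b ∈ S, (#{c ∈ C | R a c ∧ R b c} : ℝ) := by exact_mod_cast count
    rw [this, Nat.cast_sum, mul_sum]
    refine sum_le_sum fun a ha ↦ ?_
    rw [card_filter, Nat.cast_sum, mul_sum]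
    refine sum_le_sum fun b hb ↦ ?_
    split_ifs with hab
    · simpa using common a (hSA ha) b (hSA hb) hab
    · simp
  clear_value P
  have upper : ((r + 1 : ℕ) : ℝ) ^ 2 * ∑ c ∈ C, (#{a ∈ S | R a c} : ℝ) ^ 2 < #C * (#S : ℝ) ^ 2 := by
    rw [mul_sum, ← nsmul_eq_mul, ← sum_const]
    refine sum_lt_sum_of_nonempty hC fun c hc ↦ ?_
    rw [← mul_pow]
    exact pow_lt_pow_left₀ (by exact_mod_cast hS c hc) (by positivity) two_ne_zero
  have hturan : (#S : ℝ) ^ 2 ≤ r * P := by exact_mod_cast turan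
  have hr : (r : ℝ) ≤ y * ((r + 1 : ℕ) : ℝ) ^ 2 := by push_cast at hy ⊢; linarith
  have hCP : (0 : ℝ) ≤ #C * P := mul_nonneg (Nat.cast_nonneg _) (Nat.cast_nonneg _)
  have h₁ := mul_le_mul_of_nonneg_left hturan (Nat.cast_nonneg (α := ℝ) #C)
  have h₂ := mul_le_mul_of_nonneg_right hr hCP
  have h₃ := mul_le_mul_of_nonneg_left lower (sq_nonneg ((r + 1 : ℕ) : ℝ))
  linarith

theorem stmt_12 (k : ℕ) (hk : 1 ≤ k) (x y : ℝ)
    (hx : x ∈ Set.Ioc (0:ℝ) 1) (hy : y ∈ Set.Ioc (0:ℝ) 1)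
    (hy2 : ((k : ℝ) - 1) / (k : ℝ) ^ 2 ≤ y) (hxy : 1 < (k : ℝ) * x + y)
    {V : Type} [Fintype V] (G : SimpleGraph V) (A B C : Set V)
    (hG : Constrained G x y A B C)
    (hC : ∀ v ∈ C, y * B.ncard ≤ (nbrCard G v B : ℝ)) :
    ∃ v ∈ C, (A.ncard : ℝ) / k ≤ (n2card G v A : ℝ) := by
  classical
  obtain ⟨⟨-, hBne, hCne, -, hAC, -⟩, hAB, hBC, hnAC⟩ := hG
  set F : V → Finset V := fun v ↦ {b | b ∈ B ∧ G.Adj v b} with hF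
  have hFcard : ∀ v, nbrCard G v B = (F v).card := fun v ↦ by
    rw [nbrCard, ← Set.ncard_coe_finset]
    congr 1
    ext b
    simp [hF]
  have hBpos : (0 : ℝ) < B.ncard := by exact_mod_cast (Set.ncard_pos).mpr hBne
  have hkpos : (0 : ℝ) < k := by exact_mod_cast hk
  have hFB : ∀ v, F v ⊆ B.toFinset := fun v b hb ↦ by simp_all
  obtain ⟨c, hc, hcard⟩ := exists_card_le_mul_card_rel
    (fun a c ↦ ∃ b ∈ B, G.Adj a b ∧ G.Adj c b) (fun a a' ↦ ∃ b ∈ B, G.Adj a b ∧ G.Adj a' b)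
    k hk y (by rwa [div_le_iff₀ (by positivity)] at hy2) A.toFinset C.toFinset (by simpa using hCne)
    (fun a ha ↦ by
      have h := hAB a (by simpa using ha)
      rw [hFcard] at h
      have hpos : (0 : ℝ) < (F a).card := (mul_pos hx.1 hBpos).trans_le h
      obtain ⟨b, hb⟩ := Finset.card_pos.mp (by exact_mod_cast hpos)
      simp only [hF, Finset.mem_filter] at hb
      exact ⟨b, hb.2.1, hb.2.2, hb.2.2⟩)
    (fun a a' ⟨b, hb, h, h'⟩ ↦ ⟨b, hb, h', h⟩)
    (fun a _ a' _ ⟨b, hb, h, h'⟩ ↦ by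
      rw [← Set.ncard_eq_toFinset_card']
      refine (hBC b hb).trans ?_
      rw [nbrCard, Set.ncard_eq_toFinset_card']
      refine Nat.cast_le.mpr (Finset.card_le_card fun c hc ↦ ?_)
      simp only [Set.mem_toFinset, Set.mem_inter_iff, SimpleGraph.mem_neighborSet] at hc
      simp only [Finset.mem_filter, Set.mem_toFinset]
      exact ⟨hc.1, ⟨b, hb, h, hc.2.symm⟩, ⟨b, hb, h', hc.2.symm⟩⟩)
    (fun T hTA hTk ⟨c, hc, hcT⟩ ↦ by
      by_contra! hT
      have hcT' : c ∉ T := fun h ↦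
        Set.disjoint_left.mp hAC (by simpa using hTA h) (by simpa using hc)
      have hdisj : ((insert c T : Finset V) : Set V).PairwiseDisjoint F := by
        rw [Finset.coe_insert, Set.pairwiseDisjoint_insert_of_notMem (by simpa using hcT')]
        refine ⟨fun a ha a' ha' hne ↦ ?_, fun a ha ↦ ?_⟩
        · refine Finset.disjoint_left.mpr fun b hb hb' ↦ ?_
          simp only [hF, Finset.mem_filter] at hb hb'
          exact hT a ha a' ha' hne b hb.2.1 hb.2.2 hb'.2.2
        · refine Finset.disjoint_left.mpr fun b hb hb' ↦ ?_
          simp only [hF, Finset.mem_filter] at hb hb'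
          exact hcT a ha ⟨b, hb.2.1, hb'.2.2, hb.2.2⟩
      have hle : ∑ v ∈ insert c T, (F v).card ≤ B.ncard := by
        rw [← Finset.card_biUnion hdisj, Set.ncard_eq_toFinset_card']
        exact Finset.card_le_card (Finset.biUnion_subset.mpr fun v _ ↦ hFB v)
      rw [Finset.sum_insert hcT'] at hle
      have hle' : ((F c).card : ℝ) + ∑ a ∈ T, ((F a).card : ℝ) ≤ B.ncard := by exact_mod_cast hle
      have hFc := hC c (by simpa using hc)
      rw [hFcard] at hFc
      have hFT : (k : ℝ) * (x * B.ncard) ≤ ∑ a ∈ T, ((F a).card : ℝ) := by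
        rw [← hTk, ← nsmul_eq_mul]
        refine Finset.card_nsmul_le_sum _ _ _ fun a ha ↦ ?_
        rw [← hFcard]
        exact hAB a (by simpa using hTA ha)
      nlinarith)
  have hcC : c ∈ C := by simpa using hc
  refine ⟨c, hcC, ?_⟩
  rw [div_le_iff₀ hkpos, mul_comm, Set.ncard_eq_toFinset_card']
  refine (Nat.cast_le.mpr hcard).trans ?_
  rw [Nat.cast_mul, n2card, Set.ncard_eq_toFinset_card']
  refine mul_le_mul_of_nonneg_left (Nat.cast_le.mpr (Finset.card_le_card fun a ha ↦ ?_)) hkpos.le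
  simp only [Finset.mem_filter, Set.mem_toFinset] at ha
  obtain ⟨haA, b, -, hab, hcb⟩ := ha
  simp only [Set.mem_toFinset]
  exact ⟨⟨fun h ↦ hnAC a haA c hcC h.symm, fun h ↦ Set.disjoint_left.mp hAC haA (h ▸ hcC),
    b, hcb, hab.symm⟩, haA⟩
end

section
/- Let x, y ∈ (0,1] satisfy y·(1+√(2x))²/2 + x > 1. Then every graph G that is (x,y)-constrained via a tripartition (A,B,C) contains a vertex v ∈ C with |N²_A(v)| ≥ |A|/2. (That is, φ(x,y) ≥ 1/2.) -/
open Set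

open Finset in
/-- Averaging: some term of a finite sum is at least any positive lower bound of the sum divided
by the number of terms. -/
theorem exists_le_mul_card {ι : Type*} (S : Finset ι) (f : ι → ℝ) {K : ℝ} (hK : 0 < K)
    (h : K ≤ ∑ i ∈ S, f i) : ∃ i ∈ S, K ≤ f i * #S := by
  have hS : S.Nonempty := by
    rw [Finset.nonempty_iff_ne_empty]
    rintro rfl
    simp at h
    linarith
  have hpos : (0 : ℝ) < #S := by exact_mod_cast hS.card_pos
  obtain ⟨i, hi, hle⟩ := exists_le_of_sum_le (f := fun _ => K / #S) (g := f) hS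
    (by rwa [sum_const, nsmul_eq_mul, mul_div_cancel₀ K hpos.ne'])
  exact ⟨i, hi, (div_le_iff₀ hpos).1 hle⟩

/-- A form of the Cauchy–Schwarz inequality. -/
theorem sq_one_add_sqrt_div_two_le {x p q n : ℝ} (hx : 0 ≤ x) (hp : 0 < p) (hq : 0 < q)
    (hn : p + q = n) :
    (1 + √(2 * x)) ^ 2 / 2 ≤ n / 2 / p + x * n / q := by
  have ht : √(2 * x) ^ 2 = 2 * x := Real.sq_sqrt (by linarith)
  set t := √(2 * x)
  have hx' : x = t ^ 2 / 2 := by linarith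
  rw [← sub_nonneg, hx', ← hn]
  have : (p + q) / 2 / p + t ^ 2 / 2 * (p + q) / q - (1 + t) ^ 2 / 2
      = (q - t * p) ^ 2 / (2 * p * q) := by
    field_simp
    ring
  rw [this]
  positivity

open Finset in
open Classical in
/-- If every vertex of `A` has at least `x|B|` neighbours in `B`, every vertex of `B` has at least
`y|C|` neighbours in `C`, and `y(1+√(2x))²/2 + x > 1`, then some vertex of `C` reaches at least
half of `A` through `B`. -/
theorem exists_half_le_card_reachable {α β γ : Type*} (A : Finset α) (B : Finset β) (C : Finset γ)
    (hA : A.Nonempty) (hB : B.Nonempty) (hC : C.Nonempty)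
    (r : α → β → Prop) (s : β → γ → Prop) {x y : ℝ} (hx : 0 < x) (hy : 0 < y)
    (h : 1 < y * (1 + √(2 * x)) ^ 2 / 2 + x)
    (hr : ∀ a ∈ A, x * #B ≤ #{b ∈ B | r a b}) (hs : ∀ b ∈ B, y * #C ≤ #{c ∈ C | s b c}) :
    ∃ c ∈ C, (#A : ℝ) / 2 ≤ #{a ∈ A | ∃ b ∈ B, r a b ∧ s b c} := by
  by_contra! hcon
  have hB0 : (0 : ℝ) < #B := by exact_mod_cast hB.card_pos
  have hC0 : (0 : ℝ) < #C := by exact_mod_cast hC.card_pos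
  let R : α → γ → Prop := fun a c => ∃ b ∈ B, r a b ∧ s b c
  have edges_le : ∀ X ⊆ B, y * #C * #X ≤ ∑ c ∈ C, (#{b ∈ X | s b c} : ℝ) := by
    intro X hX
    have e : (∑ b ∈ X, (#{c ∈ C | s b c} : ℝ)) = ∑ c ∈ C, (#{b ∈ X | s b c} : ℝ) := by
      exact_mod_cast sum_card_bipartiteAbove_eq_sum_card_bipartiteBelow (s := X) (t := C) s
    rw [← e, mul_comm, ← nsmul_eq_mul]
    exact card_nsmul_le_sum _ _ _ fun b hb => hs b (hX hb)
  have half_lt : ∀ c ∈ C, (#A : ℝ) / 2 ≤ #{a ∈ A | ¬ R a c} := by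
    intro c hc
    have h1 : (#{a ∈ A | R a c} : ℝ) + #{a ∈ A | ¬ R a c} = #A := by
      exact_mod_cast card_filter_add_card_filter_not (s := A) (fun a => R a c)
    have h2 := hcon c hc
    change (#{a ∈ A | R a c} : ℝ) < _ at h2
    linarith
  obtain ⟨a, ha, hda⟩ : ∃ a ∈ A,
      y * #C * #B / 2 ≤ ∑ c ∈ C with ¬ R a c, (#{b ∈ B | s b c} : ℝ) := by
    apply exists_le_of_sum_le hA
    calc ∑ _a ∈ A, y * #C * #B / 2 = y * #C * #B * (#A / 2) := by
          rw [sum_const, nsmul_eq_mul]; ring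
      _ ≤ (∑ c ∈ C, (#{b ∈ B | s b c} : ℝ)) * (#A / 2) := by
          gcongr
          exact edges_le B subset_rfl
      _ ≤ ∑ c ∈ C, ∑ a ∈ A with ¬ R a c, (#{b ∈ B | s b c} : ℝ) := by
          rw [sum_mul]
          refine sum_le_sum fun c hc => ?_
          rw [sum_const, nsmul_eq_mul, mul_comm]
          gcongr
          exact half_lt c hc
      _ = ∑ a ∈ A, ∑ c ∈ C with ¬ R a c, (#{b ∈ B | s b c} : ℝ) := by
          simp_rw [sum_filter]
          exact sum_comm
  obtain ⟨c₁, hc₁, hd₁⟩ := exists_le_mul_card _ _ (by positivity) hda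
  set X := {b ∈ B | r a b} with hX
  have hXB : X ⊆ B := filter_subset _ _
  have hdX : y * #C * (x * #B) ≤ ∑ c ∈ C with R a c, (#{b ∈ X | s b c} : ℝ) := by
    refine (mul_le_mul_of_nonneg_left (hr a ha) (by positivity)).trans
      ((edges_le X hXB).trans (le_of_eq ?_))
    rw [sum_filter]
    refine sum_congr rfl fun c hc => ?_
    split_ifs with hR
    · rfl
    · rw [Nat.cast_eq_zero, card_eq_zero, filter_eq_empty_iff]
      intro b hb hsb
      rw [hX, mem_filter] at hb
      exact hR ⟨b, hb.1, hb.2, hsb⟩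
  obtain ⟨c₂, hc₂, hd₂⟩ := exists_le_mul_card _ _ (by positivity) hdX
  obtain ⟨hc₁C, hc₁R⟩ := mem_filter.1 hc₁
  obtain ⟨hc₂C, -⟩ := mem_filter.1 hc₂
  obtain ⟨a', ha', hR₁, hR₂⟩ : ∃ a' ∈ A, ¬ R a' c₁ ∧ ¬ R a' c₂ := by
    by_contra! hall
    have hsub : A ⊆ {a ∈ A | R a c₁} ∪ {a ∈ A | R a c₂} := by
      intro a' ha'
      by_cases h1 : R a' c₁
      · exact mem_union_left _ (mem_filter.2 ⟨ha', h1⟩)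
      · exact mem_union_right _ (mem_filter.2 ⟨ha', hall a' ha' h1⟩)
    have hle : (#A : ℝ) ≤ #{a ∈ A | R a c₁} + #{a ∈ A | R a c₂} := by
      exact_mod_cast (Finset.card_le_card hsub).trans (card_union_le _ _)
    have h1 : (#{a ∈ A | R a c₁} : ℝ) < _ := hcon c₁ hc₁C
    have h2 : (#{a ∈ A | R a c₂} : ℝ) < _ := hcon c₂ hc₂C
    linarith
  have hdisj : (#{b ∈ B | r a' b} : ℝ) + #{b ∈ B | s b c₁} + #{b ∈ X | s b c₂} ≤ #B := by
    have d1 : Disjoint {b ∈ B | r a' b} {b ∈ B | s b c₁} :=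
      disjoint_filter.2 fun b hb h1 h2 => hR₁ ⟨b, hb, h1, h2⟩
    have d2 : Disjoint ({b ∈ B | r a' b} ∪ {b ∈ B | s b c₁}) {b ∈ X | s b c₂} := by
      rw [Finset.disjoint_right]
      intro b hb hb'
      obtain ⟨hbX, h2⟩ := mem_filter.1 hb
      obtain ⟨hbB, hab⟩ := mem_filter.1 hbX
      rcases mem_union.1 hb' with h3 | h3
      · exact hR₂ ⟨b, hbB, (mem_filter.1 h3).2, h2⟩
      · exact hc₁R ⟨b, hbB, hab, (mem_filter.1 h3).2⟩
    have hsub : ({b ∈ B | r a' b} ∪ {b ∈ B | s b c₁}) ∪ {b ∈ X | s b c₂} ⊆ B :=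
      union_subset (union_subset (filter_subset _ _) (filter_subset _ _))
        ((filter_subset _ _).trans hXB)
    have := Finset.card_le_card hsub
    rw [card_union_of_disjoint d2, card_union_of_disjoint d1] at this
    exact_mod_cast this
  have hP : (0 : ℝ) < #{c ∈ C | ¬ R a c} := by exact_mod_cast card_pos.2 ⟨c₁, hc₁⟩
  have hQ : (0 : ℝ) < #{c ∈ C | R a c} := by exact_mod_cast card_pos.2 ⟨c₂, hc₂⟩
  have hPQ : (#{c ∈ C | ¬ R a c} : ℝ) + #{c ∈ C | R a c} = #C := by
    rw [add_comm]
    exact_mod_cast card_filter_add_card_filter_not (s := C) (fun c => R a c)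
  have key := sq_one_add_sqrt_div_two_le hx.le hP hQ hPQ
  rw [← div_le_iff₀ hP] at hd₁
  rw [← div_le_iff₀ hQ] at hd₂
  have hfin := hr a' ha'
  have hkey := mul_le_mul_of_nonneg_left key (mul_pos hy hB0).le
  have hlt := mul_lt_mul_of_pos_right h hB0
  have e : y * #B * (#C / 2 / #{c ∈ C | ¬ R a c} + x * #C / #{c ∈ C | R a c})
      = y * #C * #B / 2 / #{c ∈ C | ¬ R a c} + y * #C * (x * #B) / #{c ∈ C | R a c} := by
    ring
  rw [e] at hkey
  linarith

theorem stmt_17 (x y : ℝ) (hx : x ∈ Set.Ioc (0:ℝ) 1) (hy : y ∈ Set.Ioc (0:ℝ) 1)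
    (h : 1 < y * (1 + Real.sqrt (2 * x)) ^ 2 / 2 + x)
    {V : Type} [Fintype V] (G : SimpleGraph V) (A B C : Set V)
    (hG : Constrained G x y A B C) :
    ∃ v ∈ C, (A.ncard : ℝ) / 2 ≤ (n2card G v A : ℝ) := by
  classical
  obtain ⟨⟨hA, hB, hC, -, hAC, -⟩, hAB, hBC, hnAC⟩ := hG
  have hcard : ∀ (S : Set V) (v : V), nbrCard G v S = (S.toFinset.filter (G.Adj v)).card := by
    intro S v
    rw [nbrCard, ← Set.ncard_coe_finset]
    congr 1
    ext b
    simp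
  obtain ⟨c, hc, hle⟩ := exists_half_le_card_reachable A.toFinset B.toFinset C.toFinset
    (Set.toFinset_nonempty.2 hA) (Set.toFinset_nonempty.2 hB) (Set.toFinset_nonempty.2 hC)
    G.Adj G.Adj hx.1 hy.1 h
    (fun a ha => by
      have := hAB a (Set.mem_toFinset.1 ha)
      rw [hcard, Set.ncard_eq_toFinset_card'] at this
      convert this)
    (fun b hb => by
      have := hBC b (Set.mem_toFinset.1 hb)
      rw [hcard, Set.ncard_eq_toFinset_card'] at this
      convert this)
  rw [Set.mem_toFinset] at hc
  refine ⟨c, hc, ?_⟩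
  rw [Set.ncard_eq_toFinset_card']
  refine hle.trans ?_
  rw [n2card, Nat.cast_le, ← Set.ncard_coe_finset]
  refine Set.ncard_le_ncard ?_ (Set.toFinite _)
  intro a ha
  simp only [Finset.coe_filter, Set.mem_toFinset, Set.mem_ofPred_eq] at ha
  obtain ⟨haA, b, -, hab, hbc⟩ := ha
  exact ⟨⟨fun hca => hnAC a haA c hc hca.symm, fun hca => hAC.ne_of_mem haA hc hca.symm,
    b, hbc.symm, hab.symm⟩, haA⟩
end
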